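/- PFSym = (KP, ⋆, Δ) is a graded (by word length), cocommutative Hopf algebra over K, with unit M_ε and counit ε given by ε(M_a) = 1 if a = ε and ε(M_a) = 0 otherwise; in particular Δ is coassociative and cocommutative, Δ and ε are algebra morphisms, and an antipode exists. -/

import Mathlib

open scoped Classical

/-- Words on natural numbers (letters are intended to be positive integers). -/
abbrev W : Type := List ℕ

/-- `IsPF a` : the word `a` is a parking function, i.e. all its letters are
positive and its nondecreasing rearrangement `b₁ b₂ ⋯ bₙ` satisfies `bᵢ ≤ i`. -/
def IsPF (a : W) : Prop :=
  (∀ x ∈ a, 1 ≤ x) ∧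
    ∀ i, i < a.length → (a.insertionSort (· ≤ ·)).getD i 0 ≤ i + 1

/-- Split a word into the consecutive segments beginning at its
left-to-right minima (in the order in which they occur in the word). -/
def segs : W → List W
  | [] => []
  | x :: xs =>
      (x :: xs.takeWhile fun y => x ≤ y) :: segs (xs.dropWhile fun y => x ≤ y)
termination_by a => a.length
decreasing_by
  simpa using Nat.lt_succ_of_le (List.dropWhile_sublist _).length_le

/-- The LR-decomposition `F_a` of a word `a`: the sequence of segments beginning
at the left-to-right minima, listed in increasing order of their minimal letters
(i.e. in reverse order of occurrence in `a`). -/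
def LR (a : W) : List W := (segs a).reverse

/-- The word `w_k ⋯ w_2 w_1` encoded by an LR-decomposition `(w_1, …, w_k)`. -/
def wordOf (F : List W) : W := F.reverse.flatten

/-- A word is dominated if it is nonempty and its first letter is its minimal letter. -/
def Dominated (w : W) : Prop := w ≠ [] ∧ ∀ x ∈ w, w.headD 0 ≤ x

/-- The minimal letter of a word (`0` for the empty word). -/
def minW (w : W) : ℕ := (w.min?).getD 0

/-- Add `m` to every letter of a word. -/
def shiftW (m : ℕ) (w : W) : W := w.map (· + m)

/-- Add `m` to every letter of every word of a sequence of words. -/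
def shiftF (m : ℕ) (F : List W) : List W := F.map (shiftW m)

/-- The word whose LR-decomposition is the finite set of words `G`:
sort `G` increasingly (for dominated words with distinct minimal letters the
lexicographic order agrees with comparing the minimal letters) and concatenate
in decreasing order. -/
noncomputable def wordOfSet (G : Finset W) : W := (G.sort (· ≤ ·)).reverse.flatten

/-- Given vertex sets `X`, `Y` (of words) and a set `Θ` of edges, the resulting
set of words: concatenations `u ++ w` over edges `(u, w) ∈ Θ`, together with all
unmatched words of `X` and of `Y`. -/
noncomputable def glueSet (X Y : Finset W) (Θ : Finset (W × W)) : Finset W :=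
  Θ.image (fun p => p.1 ++ p.2) ∪
    X.filter (fun u => ∀ p ∈ Θ, p.1 ≠ u) ∪
    Y.filter (fun w => ∀ p ∈ Θ, p.2 ≠ w)

/-- `R(a,b)` : the set of matchings between `F_a` and `F_b + m` (`m` the length
of `a`), encoded as sets of edges in which no vertex occurs twice. -/
noncomputable def Rset (a b : W) : Finset (Finset (W × W)) :=
  ((LR a).toFinset ×ˢ (shiftF a.length (LR b)).toFinset).powerset.filter
    (fun Θ => ∀ p ∈ Θ, ∀ q ∈ Θ, (p.1 = q.1 ∨ p.2 = q.2) → p = q)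

/-- `aΘb` : the parking function whose LR-decomposition consists of the
concatenations `u ⬝ (w + m)` over the edges `(u, w + m)` of `Θ` together with all
unmatched words of `F_a` and of `F_b + m`. -/
noncomputable def mTheta (a b : W) (Θ : Finset (W × W)) : W :=
  wordOfSet (glueSet (LR a).toFinset (shiftF a.length (LR b)).toFinset Θ)

/-- `d(a) = min { i : #{ j : a_j ≤ i } < i }`. -/
def dVal (a : W) : ℕ :=
  Nat.find (p := fun i => (a.filter (fun x => x ≤ i)).length < i)
    ⟨a.length + 1, Nat.lt_succ_of_le (List.length_filter_le _ _)⟩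

/-- One step of the parkization algorithm: decrement every letter greater
than `d(a)`.  (This is the identity when `a` is a parking function.) -/
def parkStep (a : W) : W := a.map fun x => if dVal a < x then x - 1 else x

/-- Auxiliary fueled version of the parkization algorithm. -/
def parkFuel : ℕ → W → W
  | 0, a => a
  | k + 1, a => if dVal a = a.length + 1 then a else parkFuel k (parkStep a)

/-- The parkization `Park a` of a word `a`.  (For a word with positive letters
the algorithm needs at most `a.sum` steps, so the fuel below suffices.) -/
def Park (a : W) : W := parkFuel a.sum a

/-- The subword of `a` obtained by keeping exactly the words of `F_a`
belonging to `S`. -/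
def subWord (a : W) (S : Finset W) : W := wordOf ((LR a).filter (· ∈ S))

/-- The free module with basis indexed by words; the Hopf algebra `PFSym` is
its submodule spanned by `{M_a : a ∈ P}`. -/
abbrev FW (K : Type) [Field K] : Type := W →₀ K

/-- The monomial basis element `M_a`. -/
noncomputable def Mb (K : Type) [Field K] (a : W) : FW K := Finsupp.single a 1

/-- `M_a ⋆ M_b = Σ_{Θ ∈ R(a,b)} M_{aΘb}` on basis elements. -/
noncomputable def mulSingle (K : Type) [Field K] (a b : W) : FW K :=
  ∑ Θ ∈ Rset a b, Mb K (mTheta a b Θ)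

/-- The product `⋆`, extended bilinearly. -/
noncomputable def starF (K : Type) [Field K] (x y : FW K) : FW K :=
  x.sum fun a ca => y.sum fun b cb => (ca * cb) • mulSingle K a b

/-- The free module with basis indexed by pairs of words; it realizes the
tensor square of `FW K` via `M_a ⊗ M_b ↦ single (a,b)`. -/
abbrev FW2 (K : Type) [Field K] : Type := (W × W) →₀ K

/-- `Δ(M_a) = Σ M_{Park a'} ⊗ M_{Park a''}` over ordered pairs `(a', a'')` of
subwords of `a` with `F_{a'} ⊍ F_{a''} = F_a` (encoded by the subset
`S ⊆ F_a` of words kept in `a'`). -/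
noncomputable def deltaSingle (K : Type) [Field K] (a : W) : FW2 K :=
  ∑ S ∈ ((LR a).toFinset).powerset,
    Finsupp.single
      (Park (subWord a S), Park (subWord a (((LR a).toFinset) \ S))) 1

/-- The coproduct `Δ`, extended linearly. -/
noncomputable def deltaF (K : Type) [Field K] (x : FW K) : FW2 K :=
  x.sum fun a ca => ca • deltaSingle K a

/-- The componentwise product on the tensor square, on basis elements:
`(M_a ⊗ M_b) ⋆ (M_c ⊗ M_d) = (M_a ⋆ M_c) ⊗ (M_b ⋆ M_d)`. -/
noncomputable def star2Single (K : Type) [Field K] (p q : W × W) : FW2 K :=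
  ∑ Θ ∈ Rset p.1 q.1, ∑ Θ' ∈ Rset p.2 q.2,
    Finsupp.single (mTheta p.1 q.1 Θ, mTheta p.2 q.2 Θ') 1

/-- The componentwise product on the tensor square, extended bilinearly. -/
noncomputable def star2F (K : Type) [Field K] (x y : FW2 K) : FW2 K :=
  x.sum fun p cp => y.sum fun q cq => (cp * cq) • star2Single K p q

/-- The counit `ε` on basis elements. -/
noncomputable def epsW (K : Type) [Field K] (a : W) : K := if a = [] then 1 else 0

/-- `F_a ∘ F_b` : concatenate the `i`-th words of `F_a` and `F_b + m`
for `i ≤ min(r,s)` and keep the remaining unpaired words. -/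
def splitLR (F G : List W) : List W :=
  List.zipWith (· ++ ·) F G ++ F.drop G.length ++ G.drop F.length

/-- The split product `a ∘ b`. -/
def splitProd (a b : W) : W := wordOf (splitLR (LR a) (shiftF a.length (LR b)))

/-- A nonempty parking function is unsplitable if it is not the split product
of two nonempty parking functions. -/
def UnsplitablePF (a : W) : Prop :=
  IsPF a ∧ a ≠ [] ∧
    ¬ ∃ b c : W, IsPF b ∧ IsPF c ∧ b ≠ [] ∧ c ≠ [] ∧ a = splitProd b c

/-- The slash product `a | b = (b₁+m) ⋯ (bₙ+m) a₁ ⋯ a_m`. -/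
def slashProd (a b : W) : W := shiftW a.length b ++ a

/-- A nonempty parking function is atomic if it is not the slash product
of two nonempty parking functions. -/
def AtomicPF (a : W) : Prop :=
  IsPF a ∧ a ≠ [] ∧
    ¬ ∃ b c : W, IsPF b ∧ IsPF c ∧ b ≠ [] ∧ c ≠ [] ∧ a = slashProd b c

/-- `u ≺* v` : either `v` is a proper initial subword of `u`, or `u` is not a
proper initial subword of `v` and `u` precedes `v` lexicographically. -/
def precStar (u v : W) : Prop :=
  (v <+: u ∧ v ≠ u) ∨ (¬ (u <+: v ∧ u ≠ v) ∧ List.Lex (· < ·) u v)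

/-- `a ≺*_lex b` : `F_a` strictly precedes `F_b` in the lexicographic order
on sequences of words induced by `≺*`. -/
def precStarLex (a b : W) : Prop := List.Lex precStar (LR a) (LR b)

/-- The covering relation of `≤_*` : `b` covers `a` if `F_b` is obtained from
`F_a = (w_1, …, w_r)` by replacing `w_i` by `w_i ⬝ w_j` and removing `w_j`,
for some `i < j` such that every letter of `w_i` is at most every letter of `w_j`. -/
def CovStar (a b : W) : Prop :=
  ∃ i j, i < j ∧ j < (LR a).length ∧
    (∀ x ∈ (LR a).getD i [], ∀ y ∈ (LR a).getD j [], x ≤ y) ∧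
    LR b = ((LR a).set i ((LR a).getD i [] ++ (LR a).getD j [])).eraseIdx j

/-- The partial order `≤_*` on parking functions, generated by the covering
relations. -/
def leStar (a b : W) : Prop := Relation.ReflTransGen CovStar a b

/-- The finite set of all parking functions of length `n`. -/
noncomputable def pfFinset (n : ℕ) : Finset W :=
  ((Finset.univ : Finset (Fin n → Fin n)).image
      (fun f => List.ofFn fun i => (f i).val + 1)).filter IsPF

/-- The basis element `Q_a = Σ_{a ≤_* b} M_b`. -/
noncomputable def Qb (K : Type) [Field K] (a : W) : FW K :=
  ∑ b ∈ (pfFinset a.length).filter (fun b => leStar a b), Mb K b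

/-- `Q_x ⊗ Q_y` as an element of the tensor square. -/
noncomputable def QT (K : Type) [Field K] (x y : W) : FW2 K :=
  ∑ b ∈ (pfFinset x.length).filter (fun b => leStar x b),
    ∑ c ∈ (pfFinset y.length).filter (fun c => leStar y c),
      Finsupp.single (b, c) 1

/-- `a` is a nonincreasing word. -/
def NonInc (a : W) : Prop := a.Chain' (fun x y => y ≤ x)

/-- Every word of the LR-decomposition of `a` is nondecreasing. -/
def Nprop (a : W) : Prop := ∀ w ∈ LR a, w.Chain' (· ≤ ·)

/-- The words of the LR-decomposition of `a` have pairwise disjoint sets of letters. -/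
def Dprop (a : W) : Prop := (LR a).Pairwise (fun u v => ∀ x ∈ u, x ∉ v)

/-- `a` is a permutation of `{1, …, n}` viewed as a word. -/
def Sprop (a : W) : Prop := a.Perm (List.range' 1 a.length)


/-- Apply `Δ` to the first tensor factor: `(Δ ⊗ id)` on a basis element. -/
noncomputable def delta13 (K : Type) [Field K] (p : W × W) : (W × W × W) →₀ K :=
  Finsupp.mapDomain (fun q => (q.1, q.2, p.2)) (deltaSingle K p.1)

/-- Apply `Δ` to the second tensor factor: `(id ⊗ Δ)` on a basis element. -/
noncomputable def delta23 (K : Type) [Field K] (p : W × W) : (W × W × W) →₀ K :=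
  Finsupp.mapDomain (fun q => (p.1, q.1, q.2)) (deltaSingle K p.2)

/-- The `K`-span of the monomial basis elements indexed by parking functions
(the underlying space of `PFSym`). -/
noncomputable def KPspan (K : Type) [Field K] : Submodule K (FW K) :=
  Submodule.span K {z : FW K | ∃ a : W, IsPF a ∧ z = Mb K a}



/-! ### Segments and LR-decompositions -/

/-- first letter -/
def hd (w : W) : ℕ := w.headD 0

/-- the set of words underlying the LR-decomposition -/
def LS (a : W) : Finset W := (LR a).toFinset

/-- finite sets of dominated words with distinct first letters -/
def Good (G : Finset W) : Prop :=
  (∀ w ∈ G, Dominated w) ∧ ∀ w ∈ G, ∀ w' ∈ G, hd w = hd w' → w = w'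

theorem segs_nil : segs [] = [] := by rw [segs]

theorem segs_cons (x : ℕ) (xs : W) : segs (x :: xs) =
    (x :: xs.takeWhile fun y => x ≤ y) :: segs (xs.dropWhile fun y => x ≤ y) := by
  rw [segs]

theorem takeWhile_app (p : ℕ → Bool) (l r : W) (hl : ∀ x ∈ l, p x = true)
    (hr : ∀ x ∈ r.head?, p x = false) : (l ++ r).takeWhile p = l ∧ (l ++ r).dropWhile p = r := by
  induction l with
  | nil =>
    cases r with
    | nil => simp
    | cons y r => simp at hr; simp [hr]
  | cons y l ih =>
    have h1 := hl y (by simp)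
    have := ih (fun x hx => hl x (by simp [hx]))
    simp [h1, this]

theorem segs_flatten_of (L : List W) (h1 : ∀ w ∈ L, Dominated w)
    (h2 : L.Pairwise (fun u v => hd v < hd u)) : segs L.flatten = L := by
  induction L with
  | nil => simp [segs_nil]
  | cons w L ih =>
    have hw := h1 w (by simp)
    obtain ⟨hne, hmin⟩ := hw
    cases w with
    | nil => exact absurd rfl hne
    | cons x xs =>
      rw [List.pairwise_cons] at h2
      have ih' := ih (fun w hw => h1 w (by simp [hw])) h2.2
      have key := takeWhile_app (fun y => decide (x ≤ y)) xs L.flatten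
        (by intro y hy; have := hmin y (by simp [hy]); simpa using this)
        (by
          intro y hy
          cases L with
          | nil => simp at hy
          | cons v L =>
            have hv := h1 v (by simp)
            cases v with
            | nil => exact absurd rfl hv.1
            | cons z v =>
              have := h2.1 (z :: v) (by simp)
              simp [hd] at this hy
              subst hy
              simpa using this)
      simp only [List.flatten_cons, List.cons_append]
      rw [segs_cons, key.1, key.2, ih']

theorem segs_spec (a : W) : (segs a).flatten = a ∧ (∀ w ∈ segs a, Dominated w) ∧
    (segs a).Pairwise (fun u v => hd v < hd u) ∧ ∀ w ∈ segs a, hd w ≤ hd a := by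
  induction hn : a.length using Nat.strong_induction_on generalizing a with
  | _ n ih =>
    cases a with
    | nil => simp [segs_nil]
    | cons x xs =>
      have hlen : (xs.dropWhile fun y => decide (x ≤ y)).length < n := by
        have := (List.dropWhile_sublist (l := xs) (fun y => decide (x ≤ y))).length_le
        simp at hn; omega
      obtain ⟨i1, i2, i3, i4⟩ := ih _ hlen _ rfl
      have hlt : ∀ w ∈ segs (xs.dropWhile fun y => decide (x ≤ y)), hd w < x := by
        intro w hw
        refine lt_of_le_of_lt (i4 w hw) ?_
        cases hd' : xs.dropWhile fun y => decide (x ≤ y) with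
        | nil => rw [hd', segs_nil] at hw; simp at hw
        | cons y ys =>
          have := List.head_dropWhile_not (p := fun y => decide (x ≤ y)) (l := xs) (by rw [hd']; simp)
          simp only [hd'] at this
          have h5 := of_decide_eq_false this
          simpa [hd] using h5
      rw [segs_cons]
      refine ⟨?_, ?_, ?_, ?_⟩
      · simp [i1]
      · intro w hw
        rw [List.mem_cons] at hw
        rcases hw with rfl | hw
        · refine ⟨by simp, ?_⟩
          intro y hy
          rw [List.mem_cons] at hy
          rcases hy with rfl | hy
          · simp
          · have := List.mem_takeWhile_imp hy
            simpa using this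
        · exact i2 w hw
      · rw [List.pairwise_cons]
        exact ⟨fun w hw => by simpa [hd] using hlt w hw, i3⟩
      · intro w hw
        rw [List.mem_cons] at hw
        rcases hw with rfl | hw
        · simp [hd]
        · simpa [hd] using (hlt w hw).le

theorem lt_of_hd_lt {u v : W} (h : hd u < hd v) : u < v := by
  cases v with
  | nil => simp [hd] at h
  | cons y v =>
    cases u with
    | nil => exact List.Lex.nil
    | cons x u => exact List.Lex.rel (by simpa [hd] using h)

theorem hd_le_of_le {u v : W} (h : u ≤ v) : hd u ≤ hd v := by
  by_contra hc
  exact absurd (lt_of_hd_lt (not_le.1 hc)) (not_lt.2 h)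

theorem good_LS (a : W) : Good (LS a) := by
  obtain ⟨-, h2, h3, -⟩ := segs_spec a
  constructor
  · intro w hw; simp [LS, LR] at hw; exact h2 w hw
  · intro w hw w' hw' h
    simp [LS, LR] at hw hw'
    obtain ⟨i, hi, rfl⟩ := List.getElem_of_mem hw
    obtain ⟨j, hj, rfl⟩ := List.getElem_of_mem hw'
    rw [List.pairwise_iff_getElem] at h3
    rcases lt_trichotomy i j with hij | rfl | hij
    · have := h3 i j hi hj hij; omega
    · rfl
    · have := h3 j i hj hi hij; omega

theorem sort_of_pairwise (L : List W)
    (h2 : L.Pairwise (fun u v => hd u < hd v)) : L.toFinset.sort (· ≤ ·) = L := by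
  have h3 : L.Pairwise (· < ·) := by
    refine List.Pairwise.imp_of_mem ?_ h2
    intro u v hu hv h
    exact lt_of_hd_lt h
  rw [List.toFinset_sort]
  · exact h3.imp (fun h => h.le)
  · exact h3.imp (fun h => h.ne)

theorem LR_pairwise (a : W) : (LR a).Pairwise (fun u v => hd u < hd v) := by
  rw [LR, List.pairwise_reverse]; exact (segs_spec a).2.2.1

theorem LR_ne (a : W) : ∀ w ∈ LR a, w ≠ [] := by
  intro w hw; simp [LR] at hw; exact ((segs_spec a).2.1 w hw).1

theorem wordOfSet_LS (a : W) : wordOfSet (LS a) = a := by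
  rw [wordOfSet, LS, sort_of_pairwise _ (LR_pairwise a), LR, List.reverse_reverse]
  exact (segs_spec a).1

theorem LS_wordOfSet {G : Finset W} (h : Good G) : LS (wordOfSet G) = G := by
  rw [LS, LR, wordOfSet, segs_flatten_of]
  · simp
  · intro w hw; simp at hw; exact h.1 w hw
  · rw [List.pairwise_reverse]
    have h3 : (G.sort (· ≤ ·)).Pairwise (· < ·) := (Finset.sortedLT_sort G).pairwise
    refine List.Pairwise.imp_of_mem ?_ h3
    intro u v hu hv huv
    simp at hu hv
    have h4 := hd_le_of_le huv.le
    have : hd u ≠ hd v := fun e => huv.ne (h.2 u hu v hv e)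
    omega

theorem subWord_eq (a : W) (S : Finset W) (h : S ⊆ LS a) : subWord a S = wordOfSet S := by
  rw [subWord, wordOf, wordOfSet]
  have : ((LR a).filter (· ∈ S)).toFinset = S := by
    ext w
    simp only [List.mem_toFinset, List.mem_filter, decide_eq_true_eq]
    constructor
    · exact fun h => h.2
    · intro hw; exact ⟨by simpa [LS] using h hw, hw⟩
  conv_rhs => rw [← this]
  rw [sort_of_pairwise]
  · exact (LR_pairwise a).filter _

theorem Good.subset {S G : Finset W} (h : Good G) (hs : S ⊆ G) : Good S :=
  ⟨fun w hw => h.1 w (hs hw), fun w hw w' hw' => h.2 w (hs hw) w' (hs hw')⟩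

theorem Good.nil_not_mem {G : Finset W} (h : Good G) : [] ∉ G := fun hn => (h.1 _ hn).1 rfl

theorem LS_map (f : ℕ → ℕ) (a : W) (hf : ∀ x ∈ a, ∀ y ∈ a, x < y → f x < f y) :
    LS (a.map f) = (LS a).image (List.map f) := by
  obtain ⟨h1, h2, h3, -⟩ := segs_spec a
  have hm : ∀ w ∈ segs a, ∀ x ∈ w, x ∈ a := by
    intro w hw x hx
    rw [← h1]; exact List.mem_flatten.2 ⟨w, hw, hx⟩
  have : segs (a.map f) = (segs a).map (List.map f) := by
    conv_lhs => rw [← h1, List.map_flatten]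
    apply segs_flatten_of
    · intro w hw
      rw [List.mem_map] at hw
      obtain ⟨v, hv, rfl⟩ := hw
      have hd' := h2 v hv
      have hmv := hm v hv
      cases v with
      | nil => exact absurd rfl hd'.1
      | cons x xs =>
        refine ⟨by simp, ?_⟩
        intro y hy
        rw [List.mem_map] at hy
        obtain ⟨z, hz, rfl⟩ := hy
        have := hd'.2 z hz
        simp at this
        rcases this.lt_or_eq with h | h
        · simpa using (hf x (hmv x (by simp)) z (hmv z hz) h).le
        · simp [h]
    · rw [List.pairwise_map]
      refine List.Pairwise.imp_of_mem ?_ h3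
      intro u v hu hv h
      have hu' := (h2 u hu).1
      have hv' := (h2 v hv).1
      have hmu := hm u hu
      have hmv := hm v hv
      cases u with
      | nil => exact absurd rfl hu'
      | cons x u =>
        cases v with
        | nil => exact absurd rfl hv'
        | cons y v =>
          simp [hd] at h ⊢
          exact hf y (hmv y (by simp)) x (hmu x (by simp)) h
  simp only [LS, LR, this, ← List.map_reverse]
  ext w; simp

theorem sum_sort {β : Type*} [AddCommMonoid β] (G : Finset W) (f : W → β) :
    ((G.sort (· ≤ ·)).map f).sum = ∑ w ∈ G, f w := by
  conv_rhs => rw [← Finset.sort_toFinset (s := G) (r := (· ≤ ·))]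
  rw [List.sum_toFinset _ (Finset.sort_nodup _ _)]

theorem mem_wordOfSet (G : Finset W) (x : ℕ) : x ∈ wordOfSet G ↔ ∃ w ∈ G, x ∈ w := by
  simp [wordOfSet, List.mem_flatten]

theorem length_wordOfSet (G : Finset W) : (wordOfSet G).length = ∑ w ∈ G, w.length := by
  rw [wordOfSet, List.length_flatten, List.map_reverse, List.sum_reverse, sum_sort]

/-- number of letters at most i -/
def cnt (a : W) (i : ℕ) : ℕ := a.countP (fun x => x ≤ i)

/-- number of letters at most i -/
def cntS (G : Finset W) (i : ℕ) : ℕ := ∑ w ∈ G, cnt w i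

theorem cnt_wordOfSet (G : Finset W) (i : ℕ) : cnt (wordOfSet G) i = cntS G i := by
  rw [cnt, wordOfSet, List.countP_flatten, List.map_reverse, List.sum_reverse, sum_sort]; rfl

theorem cnt_mono (a : W) {i j : ℕ} (h : i ≤ j) : cnt a i ≤ cnt a j := by
  apply List.countP_mono_left
  intro x _ hx; simp at hx ⊢; omega

theorem cntS_mono (G : Finset W) {i j : ℕ} (h : i ≤ j) : cntS G i ≤ cntS G j :=
  Finset.sum_le_sum fun w _ => cnt_mono w h

theorem cnt_le (a : W) (i : ℕ) : cnt a i ≤ a.length := List.countP_le_length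


/-! ### Parkization -/

/-- closed recursive form of the parkization map -/
def pk (N : ℕ → ℕ) : ℕ → ℕ
  | 0 => 0
  | x + 1 => min (pk N x) (N x) + 1

theorem pk_succ (N : ℕ → ℕ) (x : ℕ) : pk N (x + 1) = min (pk N x) (N x) + 1 := rfl

theorem pk_pos (N : ℕ → ℕ) {x : ℕ} (h : 1 ≤ x) : 1 ≤ pk N x := by
  obtain ⟨y, rfl⟩ : ∃ y, x = y + 1 := ⟨x - 1, by omega⟩
  rw [pk_succ]; omega

theorem pk_le_cnt {N : ℕ → ℕ} (hN : Monotone N) (x : ℕ) : pk N x ≤ N x + 1 := by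
  cases x with
  | zero => simp [pk]
  | succ x => have := hN (Nat.le_succ x); rw [pk_succ]; simp at this; omega

theorem pk_mono {N : ℕ → ℕ} (hN : Monotone N) : Monotone (pk N) := by
  apply monotone_nat_of_le_succ
  intro x
  have := pk_le_cnt hN x
  rw [pk_succ]; omega

theorem pk_congr {N N' : ℕ → ℕ} (x : ℕ) (h : ∀ i < x, N i = N' i) : pk N x = pk N' x := by
  induction x with
  | zero => rfl
  | succ x ih =>
    rw [pk_succ, pk_succ, ih (fun i hi => h i (by omega)), h x (by omega)]

theorem pk_ineq {T R : ℕ → ℕ} (hR : Monotone R) (x : ℕ) :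
    pk (fun i => T i + R i) x ≤ pk T x + R x := by
  induction x with
  | zero => simp [pk]
  | succ x ih =>
    have := hR (Nat.le_succ x)
    rw [pk_succ, pk_succ]; simp at this; omega

theorem pk_strict {N : ℕ → ℕ} (hN : Monotone N) {x y : ℕ} (hx : N (x - 1) < N x) (h1 : 1 ≤ x)
    (hxy : x < y) : pk N x < pk N y := by
  have h2 : pk N (x + 1) ≤ pk N y := pk_mono hN hxy
  obtain ⟨z, rfl⟩ : ∃ z, x = z + 1 := ⟨x - 1, by omega⟩
  simp at hx
  rw [pk_succ, pk_succ] at h2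
  rw [pk_succ]; omega

theorem pk_comp {T R U : ℕ → ℕ} (hT : Monotone T) (hR : Monotone R)
    (hU : ∀ x, pk (fun i => T i + R i) x < pk (fun i => T i + R i) (x + 1) →
      U (pk (fun i => T i + R i) x) = T x) (x : ℕ) :
    pk U (pk (fun i => T i + R i) x) = pk T x := by
  induction x with
  | zero => simp [pk]
  | succ x ih =>
    have hU := hU x
    have h1 := pk_ineq (T := T) hR x
    have h2 := pk_le_cnt hT x
    have h3 := pk_succ (fun i => T i + R i) x
    have hNm : Monotone (fun i => T i + R i) := fun i j hij => add_le_add (hT hij) (hR hij)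
    have h4 := pk_le_cnt hNm x
    by_cases hc : pk (fun i => T i + R i) x ≤ T x + R x
    · have h5 : pk (fun i => T i + R i) (x + 1) = pk (fun i => T i + R i) x + 1 := by omega
      rw [h5, pk_succ, pk_succ, ih, hU (by omega)]
    · have h5 : pk (fun i => T i + R i) (x + 1) = pk (fun i => T i + R i) x := by omega
      rw [h5, ih, pk_succ]; omega

/-- words with positive letters -/
def Pos (a : W) : Prop := ∀ x ∈ a, 1 ≤ x

theorem cnt_monotone (a : W) : Monotone (cnt a) := fun _ _ h => cnt_mono a h

theorem cnt_map_pk {N : ℕ → ℕ} (hN : Monotone N) (t : W) (x : ℕ) (hx : pk N x < pk N (x + 1)) :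
    cnt (t.map (pk N)) (pk N x) = cnt t x := by
  rw [cnt, cnt, List.countP_map]
  apply List.countP_congr
  intro y _
  simp only [Function.comp, decide_eq_true_eq]
  constructor
  · intro h
    by_contra hc
    have := pk_mono hN (show x + 1 ≤ y by omega)
    omega
  · intro h; exact pk_mono hN h

theorem cnt_lt_of_mem {a : W} {x : ℕ} (hx : x ∈ a) (h1 : 1 ≤ x) : cnt a (x - 1) < cnt a x := by
  induction a with
  | nil => simp at hx
  | cons y a ih =>
    rw [List.mem_cons] at hx
    rw [cnt, cnt, List.countP_cons, List.countP_cons]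
    have h2 := cnt_mono a (Nat.sub_le x 1)
    rw [cnt, cnt] at h2
    rcases hx with rfl | hx
    · have : ¬ (x ≤ x - 1) := by omega
      simp [this]; omega
    · have := ih hx
      rw [cnt, cnt] at this
      by_cases hy : y ≤ x - 1
      · have : y ≤ x := by omega
        simp [*]
      · simp [hy]; omega

theorem sorted_getD_le (L : W) (hL : L.Pairwise (· ≤ ·)) (t i : ℕ) (hi : i < L.length) :
    L.getD i 0 ≤ t ↔ i < cnt L t := by
  induction L generalizing i with
  | nil => simp at hi
  | cons y L ih =>
    rw [List.pairwise_cons] at hL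
    rw [cnt, List.countP_cons]
    have h0 : t < y → cnt L t = 0 := by
      intro h
      rw [cnt, List.countP_eq_zero]
      intro z hz; have := hL.1 z hz; simp; omega
    rw [cnt] at h0
    cases i with
    | zero =>
      by_cases h : y ≤ t
      · simp [h]
      · rw [h0 (by omega)]; simp [h]
    | succ i =>
      simp at hi
      have := ih hL.2 i (by omega)
      rw [cnt] at this
      rw [List.getD_cons_succ, this]
      by_cases h : y ≤ t
      · simp [h]
      · simp [h, h0 (by omega)]

theorem isPF_iff (a : W) : IsPF a ↔ Pos a ∧ ∀ i ≤ a.length, i ≤ cnt a i := by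
  unfold IsPF
  apply and_congr Iff.rfl
  have hp := List.perm_insertionSort (· ≤ ·) a
  have hs : (a.insertionSort (· ≤ ·)).Pairwise (· ≤ ·) := List.pairwise_insertionSort _ a
  have hc : ∀ i, cnt (a.insertionSort (· ≤ ·)) i = cnt a i := fun i => hp.countP_eq _
  constructor
  · intro h i hi
    cases i with
    | zero => simp
    | succ i =>
      have := (sorted_getD_le _ hs (i + 1) i (by rw [hp.length_eq]; omega)).1 (h i (by omega))
      rw [hc] at this; omega
  · intro h i hi
    apply (sorted_getD_le _ hs (i + 1) i (by rw [hp.length_eq]; omega)).2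
    rw [hc]; have := h (i + 1) (by omega); omega

theorem dVal_spec (a : W) : cnt a (dVal a) < dVal a ∧ (∀ i < dVal a, i ≤ cnt a i) ∧
    dVal a ≤ a.length + 1 := by
  have he : ∀ i, (a.filter (fun x => x ≤ i)).length = cnt a i := by
    intro i; rw [cnt, List.countP_eq_length_filter]
  refine ⟨?_, ?_, ?_⟩
  · rw [← he]
    exact Nat.find_spec (p := fun i => (a.filter (fun x => x ≤ i)).length < i)
      ⟨a.length + 1, Nat.lt_succ_of_le (List.length_filter_le _ _)⟩
  · intro i hi
    have := Nat.find_min (p := fun i => (a.filter (fun x => x ≤ i)).length < i)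
      ⟨a.length + 1, Nat.lt_succ_of_le (List.length_filter_le _ _)⟩ hi
    rw [he] at this; omega
  · exact Nat.find_min' _ (Nat.lt_succ_of_le (List.length_filter_le _ _))

theorem pk_eq_self {N : ℕ → ℕ} (x : ℕ) (h : ∀ i < x, i ≤ N i) : pk N x = x := by
  induction x with
  | zero => rfl
  | succ x ih =>
    rw [pk_succ, ih (fun i hi => h i (by omega))]
    have := h x (by omega); omega

theorem park_step (a : W) (hp : Pos a) (hd : dVal a ≤ a.length) :
    (parkStep a).map (pk (cnt (parkStep a))) = a.map (pk (cnt a)) ∧ Pos (parkStep a) ∧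
      (parkStep a).sum < a.sum := by
  obtain ⟨h1, h2, h3⟩ := dVal_spec a
  set d := dVal a with hdd
  have h4 : d - 1 ≤ cnt a (d - 1) := h2 (d - 1) (by omega)
  have hna : d ∉ a := by
    intro hm
    have := cnt_lt_of_mem hm (by omega)
    omega
  have hcd : cnt a d = d - 1 := by
    have := cnt_mono a (Nat.sub_le d 1); omega
  have hst : parkStep a = a.map fun x => if d < x then x - 1 else x := rfl
  have hlo : ∀ i < d, cnt (parkStep a) i = cnt a i := by
    intro i hi
    rw [hst, cnt, cnt, List.countP_map]
    apply List.countP_congr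
    intro y _
    simp only [Function.comp, decide_eq_true_eq]
    split_ifs <;> omega
  have hhi : ∀ i, d ≤ i → cnt (parkStep a) i = cnt a (i + 1) := by
    intro i hi
    rw [hst, cnt, cnt, List.countP_map]
    apply List.countP_congr
    intro y _
    simp only [Function.comp, decide_eq_true_eq]
    split_ifs <;> omega
  have e1 : ∀ x ≤ d, pk (cnt a) x = x := fun x hx => pk_eq_self x (fun i hi => h2 i (by omega))
  have e2 : ∀ x ≤ d, pk (cnt (parkStep a)) x = x :=
    fun x hx => pk_eq_self x (fun i hi => by rw [hlo i (by omega)]; exact h2 i (by omega))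
  have e3 : ∀ k, pk (cnt (parkStep a)) (d + k) = pk (cnt a) (d + k + 1) := by
    intro k
    induction k with
    | zero =>
      rw [Nat.add_zero, e2 d le_rfl, pk_succ, e1 d le_rfl, hcd]; omega
    | succ k ih =>
      rw [← Nat.add_assoc, pk_succ, ih, hhi _ (by omega), pk_succ (cnt a) (d + k + 1)]
  refine ⟨?_, ?_, ?_⟩
  · conv_lhs => rw [hst, List.map_map, ← hst]
    apply List.map_congr_left
    intro x hx
    simp only [Function.comp]
    split_ifs with h
    · obtain ⟨k, rfl⟩ : ∃ k, x = d + k + 1 := ⟨x - d - 1, by omega⟩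
      exact e3 k
    · rw [e1 x (by omega), e2 x (by omega)]
  · intro x hx
    rw [hst, List.mem_map] at hx
    obtain ⟨y, hy, rfl⟩ := hx
    have := hp y hy
    split_ifs <;> omega
  · have hex : ∃ x ∈ a, d < x := by
      by_contra hc
      push Not at hc
      have : cnt a d = a.length := by
        rw [cnt, List.countP_eq_length]
        intro x hx; simpa using hc x hx
      omega
    rw [hst]
    conv_rhs => rw [← List.map_id a]
    apply List.sum_lt_sum
    · intro x _; simp only [id]; split_ifs <;> omega
    · obtain ⟨x, hx, hdx⟩ := hex
      exact ⟨x, hx, by simp [hdx]; omega⟩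

theorem parkFuel_spec (k : ℕ) (a : W) (hp : Pos a) (hk : a.sum ≤ k) :
    parkFuel k a = a.map (pk (cnt a)) ∧ IsPF (parkFuel k a) := by
  induction k generalizing a with
  | zero =>
    have : a = [] := by
      cases a with
      | nil => rfl
      | cons x a =>
        have := hp x (by simp)
        simp at hk; omega
    subst this
    simp [parkFuel, IsPF]
  | succ k ih =>
    rw [parkFuel]
    obtain ⟨h1, h2, h3⟩ := dVal_spec a
    split_ifs with h
    · constructor
      · conv_lhs => rw [← List.map_id a]
        apply List.map_congr_left
        intro x hx
        have hpx := hp x hx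
        rw [id]
        -- letters are at most the length
        have hle : x ≤ a.length := by
          by_contra hc
          have h5 := cnt_lt_of_mem hx hpx
          have h6 := h2 a.length (by omega)
          have h7 := cnt_mono a (show a.length ≤ x - 1 by omega)
          have h8 := cnt_le a x
          omega
        rw [pk_eq_self x (fun i hi => h2 i (by omega))]
      · rw [isPF_iff]
        exact ⟨hp, fun i hi => h2 i (by omega)⟩
    · obtain ⟨s1, s2, s3⟩ := park_step a hp (by omega)
      rw [← s1]
      exact ih _ s2 (by omega)

theorem Park_eq {a : W} (hp : Pos a) : Park a = a.map (pk (cnt a)) :=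
  (parkFuel_spec _ a hp le_rfl).1

theorem isPF_Park {a : W} (hp : Pos a) : IsPF (Park a) :=
  (parkFuel_spec _ a hp le_rfl).2

theorem IsPF.pos {a : W} (h : IsPF a) : Pos a := ((isPF_iff a).1 h).1

theorem IsPF.cnt_length {a : W} (h : IsPF a) : cnt a a.length = a.length :=
  le_antisymm (cnt_le _ _) (((isPF_iff a).1 h).2 _ le_rfl)

theorem IsPF.le_length {a : W} (h : IsPF a) {x : ℕ} (hx : x ∈ a) : x ≤ a.length := by
  have := h.cnt_length
  rw [cnt, List.countP_eq_length] at this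
  simpa using this x hx

theorem IsPF.pk_length {a : W} (h : IsPF a) {x : ℕ} (hx : x ≤ a.length) : pk (cnt a) x = x :=
  pk_eq_self x fun i hi => ((isPF_iff a).1 h).2 i (by omega)

theorem Park_of_PF {a : W} (h : IsPF a) : Park a = a := by
  rw [Park_eq h.pos]
  conv_rhs => rw [← List.map_id a]
  apply List.map_congr_left
  intro x hx
  exact h.pk_length (h.le_length hx)


/-! ### Parkization of sets of words -/

/-- parkized word of a set of words -/
noncomputable def PkW (S : Finset W) : W := Park (wordOfSet S)

/-- all letters positive -/
def PosS (S : Finset W) : Prop := ∀ w ∈ S, Pos w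

/-- letterwise map on sets of words -/
noncomputable def mp (f : ℕ → ℕ) (G : Finset W) : Finset W := G.image (List.map f)

theorem PosS.subset {S T : Finset W} (h : PosS S) (hT : T ⊆ S) : PosS T := fun w hw => h w (hT hw)

theorem PosS.pos {S : Finset W} (h : PosS S) : Pos (wordOfSet S) := by
  intro x hx
  obtain ⟨w, hw, hx⟩ := (mem_wordOfSet S x).1 hx
  exact h w hw x hx

theorem cntS_eq (S : Finset W) : cnt (wordOfSet S) = cntS S := funext (cnt_wordOfSet S)

theorem PkW_eq {S : Finset W} (h : PosS S) : PkW S = (wordOfSet S).map (pk (cntS S)) := by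
  rw [PkW, Park_eq h.pos, cntS_eq]

theorem cntS_monotone (S : Finset W) : Monotone (cntS S) := fun _ _ h => cntS_mono S h

theorem cntS_lt_of_mem {S : Finset W} (hp : PosS S) {x : ℕ} (hx : ∃ w ∈ S, x ∈ w) :
    cntS S (x - 1) < cntS S x := by
  rw [← cntS_eq]
  have := (mem_wordOfSet S x).2 hx
  exact cnt_lt_of_mem this (hp.pos x this)

theorem pkS_strict {S T : Finset W} (hp : PosS S) (hT : T ⊆ S) :
    ∀ x ∈ wordOfSet T, ∀ y ∈ wordOfSet T, x < y → pk (cntS S) x < pk (cntS S) y := by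
  intro x hx y _ h
  obtain ⟨w, hw, hxw⟩ := (mem_wordOfSet T x).1 hx
  exact pk_strict (cntS_monotone S) (cntS_lt_of_mem hp ⟨w, hT hw, hxw⟩) (hp w (hT hw) x hxw) h

theorem LS_map_pk {S T : Finset W} (hg : Good S) (hp : PosS S) (hT : T ⊆ S) :
    LS ((wordOfSet T).map (pk (cntS S))) = mp (pk (cntS S)) T := by
  rw [LS_map _ _ (pkS_strict hp hT), LS_wordOfSet (hg.subset hT), mp]

theorem LS_PkW {S : Finset W} (hg : Good S) (hp : PosS S) :
    LS (PkW S) = mp (pk (cntS S)) S := by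
  rw [PkW_eq hp, LS_map_pk hg hp le_rfl]

theorem wordOfSet_mp_pk {S : Finset W} (hg : Good S) (hp : PosS S) :
    wordOfSet (mp (pk (cntS S)) S) = PkW S := by
  rw [← LS_PkW hg hp, wordOfSet_LS]

theorem cntS_split {S T : Finset W} (hT : T ⊆ S) :
    cntS S = fun i => cntS T i + cntS (S \ T) i := by
  funext i
  rw [cntS, cntS, cntS, add_comm, Finset.sum_sdiff hT]

theorem PkW_mp {S T : Finset W} (hg : Good S) (hp : PosS S) (hT : T ⊆ S) :
    PkW (mp (pk (cntS S)) T) = PkW T := by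
  have h1 : wordOfSet (mp (pk (cntS S)) T) = (wordOfSet T).map (pk (cntS S)) := by
    rw [← LS_map_pk hg hp hT, wordOfSet_LS]
  have hpos : Pos ((wordOfSet T).map (pk (cntS S))) := by
    intro x hx
    rw [List.mem_map] at hx
    obtain ⟨y, hy, rfl⟩ := hx
    exact pk_pos _ ((hp.subset hT).pos y hy)
  rw [PkW_eq (hp.subset hT), PkW, h1, Park_eq hpos, List.map_map]
  apply List.map_congr_left
  intro x _
  simp only [Function.comp]
  have hs := cntS_split hT
  have h2 := cnt_map_pk (cntS_monotone S) (wordOfSet T)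
  rw [hs] at h2 ⊢
  rw [pk_comp (cntS_monotone T) (cntS_monotone _)]
  intro y hy
  rw [h2 y hy, cntS_eq]

theorem length_PkW {S : Finset W} (h : PosS S) : (PkW S).length = ∑ w ∈ S, w.length := by
  rw [PkW_eq h, List.length_map, length_wordOfSet]

theorem length_PkW' {S : Finset W} (h : PosS S) : (PkW S).length = (wordOfSet S).length := by
  rw [PkW_eq h, List.length_map]

theorem isPF_PkW {S : Finset W} (h : PosS S) : IsPF (PkW S) := isPF_Park h.pos

theorem posS_LS {a : W} (h : Pos a) : PosS (LS a) := by
  intro w hw x hx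
  apply h x
  rw [← wordOfSet_LS a, mem_wordOfSet]
  exact ⟨w, hw, hx⟩

theorem PkW_LS {a : W} (h : IsPF a) : PkW (LS a) = a := by
  rw [PkW, wordOfSet_LS, Park_of_PF h]

theorem wordOfSet_empty : wordOfSet ∅ = [] := by simp [wordOfSet]

theorem PkW_empty : PkW ∅ = [] := by
  rw [PkW_eq (by intro w hw; simp at hw), wordOfSet_empty]; rfl

theorem PkW_eq_nil {S : Finset W} (hg : Good S) (h : PosS S) : PkW S = [] ↔ S = ∅ := by
  constructor
  · intro h1
    have h2 := length_PkW h
    rw [h1] at h2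
    by_contra hne
    obtain ⟨w, hw⟩ := Finset.nonempty_iff_ne_empty.2 hne
    have h3 : w.length ≤ ∑ w ∈ S, w.length :=
      Finset.single_le_sum (f := fun w : W => w.length) (fun _ _ => Nat.zero_le _) hw
    have h4 := List.length_pos_iff.2 (hg.1 w hw).1
    simp at h2
    omega
  · rintro rfl; exact PkW_empty

theorem sum_powerset_image {α β γ : Type*} [DecidableEq α] [DecidableEq β] [AddCommMonoid γ]
    (S : Finset α) (g : α → β) (hg : Set.InjOn g S) (φ : Finset β → γ) :
    ∑ T ∈ (S.image g).powerset, φ T = ∑ T ∈ S.powerset, φ (T.image g) := by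
  symm
  apply Finset.sum_bij (fun T _ => T.image g)
  · intro T hT
    rw [Finset.mem_powerset] at hT ⊢
    exact Finset.image_subset_image hT
  · intro T hT T' hT' h
    rw [Finset.mem_powerset] at hT hT'
    have key : ∀ A B : Finset α, A ⊆ S → B ⊆ S → A.image g ⊆ B.image g → A ⊆ B := by
      intro A B hA hB hAB x hx
      obtain ⟨y, hy, hxy⟩ := Finset.mem_image.1 (hAB (Finset.mem_image_of_mem g hx))
      rw [← hg (hB hy) (hA hx) hxy]; exact hy
    exact Finset.Subset.antisymm (key _ _ hT hT' h.subset) (key _ _ hT' hT h.symm.subset)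
  · intro T hT
    rw [Finset.mem_powerset, Finset.subset_image_iff] at hT
    obtain ⟨T', hT', h⟩ := hT
    exact ⟨T', Finset.mem_powerset.2 (by exact_mod_cast hT'), h⟩
  · intros; rfl

theorem map_injOn_pk {S : Finset W} (hp : PosS S) :
    Set.InjOn (List.map (pk (cntS S))) (S : Set W) := by
  have hinj : ∀ x ∈ wordOfSet S, ∀ y ∈ wordOfSet S, pk (cntS S) x = pk (cntS S) y → x = y := by
    intro x hx y hy h
    have h1 := pkS_strict hp le_rfl x hx y hy
    have h2 := pkS_strict hp le_rfl y hy x hx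
    by_contra hne
    rcases lt_or_gt_of_ne hne with h3 | h3
    · have := h1 h3; omega
    · have := h2 h3; omega
  intro u hu v hv h
  have hu' : ∀ x ∈ u, x ∈ wordOfSet S := fun x hx => (mem_wordOfSet S x).2 ⟨u, hu, hx⟩
  have hv' : ∀ x ∈ v, x ∈ wordOfSet S := fun x hx => (mem_wordOfSet S x).2 ⟨v, hv, hx⟩
  clear hu hv
  induction u generalizing v with
  | nil => simpa using h.symm
  | cons x u ih =>
    cases v with
    | nil => simp at h
    | cons y v =>
      simp only [List.map_cons, List.cons.injEq] at h
      rw [hinj x (hu' x (by simp)) y (hv' y (by simp)) h.1,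
        ih h.2 (fun z hz => hu' z (by simp [hz])) (fun z hz => hv' z (by simp [hz]))]

theorem deltaSingle_eq (K : Type) [Field K] (a : W) : deltaSingle K a =
    ∑ S ∈ (LS a).powerset, Finsupp.single (PkW S, PkW (LS a \ S)) 1 := by
  rw [deltaSingle]
  change ∑ S ∈ (LS a).powerset, Finsupp.single
      (Park (subWord a S), Park (subWord a (LS a \ S))) 1 = _
  apply Finset.sum_congr rfl
  intro S hS
  rw [Finset.mem_powerset] at hS
  rw [subWord_eq a S hS, subWord_eq a _ Finset.sdiff_subset]
  rfl

theorem deltaSingle_PkW (K : Type) [Field K] {S : Finset W} (hg : Good S) (hp : PosS S) :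
    deltaSingle K (PkW S) =
    ∑ T ∈ S.powerset, Finsupp.single (PkW T, PkW (S \ T)) 1 := by
  rw [deltaSingle_eq, LS_PkW hg hp, mp, sum_powerset_image S _ (map_injOn_pk hp)]
  apply Finset.sum_congr rfl
  intro T hT
  rw [Finset.mem_powerset] at hT
  have h1 := PkW_mp hg hp hT
  have h2 := PkW_mp hg hp (Finset.sdiff_subset (s := S) (t := T))
  rw [mp] at h1 h2
  rw [← Finset.image_sdiff_of_injOn (map_injOn_pk hp) hT, h1, h2]


/-! ### Products of sets of words -/

/-- low part of a word -/
def lo (m : ℕ) (w : W) : W := w.filter (fun x => x ≤ m)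
/-- high part of a word -/
def hi (m : ℕ) (w : W) : W := w.filter (fun x => m < x)

/-- nonempty low parts -/
noncomputable def loS (m : ℕ) (G : Finset W) : Finset W := (G.image (lo m)).erase []
/-- nonempty high parts -/
noncomputable def hiS (m : ℕ) (G : Finset W) : Finset W := (G.image (hi m)).erase []

theorem mem_loS {m : ℕ} {G : Finset W} {u : W} : u ∈ loS m G ↔ u ≠ [] ∧ ∃ w ∈ G, lo m w = u := by
  simp [loS]
theorem mem_hiS {m : ℕ} {G : Finset W} {u : W} : u ∈ hiS m G ↔ u ≠ [] ∧ ∃ w ∈ G, hi m w = u := by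
  simp [hiS]

/-- splittable sets at level m -/
structure Sp (m : ℕ) (G : Finset W) : Prop where
  nil : [] ∉ G
  app : ∀ w ∈ G, lo m w ++ hi m w = w
  linj : ∀ w ∈ G, ∀ v ∈ G, lo m w = lo m v → lo m w ≠ [] → w = v
  hinj : ∀ w ∈ G, ∀ v ∈ G, hi m w = hi m v → hi m w ≠ [] → w = v

/-- G is a term of the product of X and Y -/
structure IsP (m : ℕ) (X Y G : Finset W) : Prop where
  sp : Sp m G
  low : loS m G = X
  high : hiS m G = Y

theorem lo_append (m : ℕ) (u v : W) : lo m (u ++ v) = lo m u ++ lo m v := by simp [lo]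
theorem hi_append (m : ℕ) (u v : W) : hi m (u ++ v) = hi m u ++ hi m v := by simp [hi]
theorem lo_nil (m : ℕ) : lo m [] = [] := rfl
theorem hi_nil (m : ℕ) : hi m [] = [] := rfl

theorem lo_lo {m m' : ℕ} (h : m ≤ m') (w : W) : lo m (lo m' w) = lo m w := by
  rw [lo, lo, lo, List.filter_filter]
  apply List.filter_congr
  intro x _
  simp; omega
theorem lo_lo' {m m' : ℕ} (h : m ≤ m') (w : W) : lo m' (lo m w) = lo m w := by
  rw [lo, lo, List.filter_filter]
  apply List.filter_congr
  intro x _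
  simp; omega
theorem hi_hi {m m' : ℕ} (h : m ≤ m') (w : W) : hi m' (hi m w) = hi m' w := by
  rw [hi, hi, hi, List.filter_filter]
  apply List.filter_congr
  intro x _
  simp; omega
theorem hi_hi' {m m' : ℕ} (h : m ≤ m') (w : W) : hi m (hi m' w) = hi m' w := by
  rw [hi, hi, List.filter_filter]
  apply List.filter_congr
  intro x _
  simp; omega
theorem hi_lo {m m' : ℕ} (w : W) : hi m (lo m' w) = lo m' (hi m w) := by
  rw [hi, lo, hi, lo, List.filter_comm]
theorem hi_lo_nil {m m' : ℕ} (h : m ≤ m') (w : W) : hi m' (lo m w) = [] := by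
  rw [hi, lo, List.filter_filter, List.filter_eq_nil_iff]
  intro x _
  simp; omega
theorem lo_hi_nil {m m' : ℕ} (h : m ≤ m') (w : W) : lo m (hi m' w) = [] := by
  rw [hi, lo, List.filter_filter, List.filter_eq_nil_iff]
  intro x _
  simp; omega

theorem lo_eq_self {m : ℕ} {w : W} (h : ∀ x ∈ w, x ≤ m) : lo m w = w := by
  rw [lo, List.filter_eq_self]; simpa using h
theorem hi_eq_self {m : ℕ} {w : W} (h : ∀ x ∈ w, m < x) : hi m w = w := by
  rw [hi, List.filter_eq_self]; simpa using h
theorem lo_eq_nil {m : ℕ} {w : W} (h : ∀ x ∈ w, m < x) : lo m w = [] := by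
  rw [lo, List.filter_eq_nil_iff]; simpa using h
theorem hi_eq_nil {m : ℕ} {w : W} (h : ∀ x ∈ w, x ≤ m) : hi m w = [] := by
  rw [hi, List.filter_eq_nil_iff]; simpa using h

theorem loS_loS {m m' : ℕ} (h : m ≤ m') (H : Finset W) : loS m (loS m' H) = loS m H := by
  ext u
  simp only [mem_loS]
  constructor
  · rintro ⟨hu, v, ⟨_, w, hw, rfl⟩, rfl⟩
    exact ⟨hu, w, hw, (lo_lo h w).symm⟩
  · rintro ⟨hu, w, hw, rfl⟩
    refine ⟨hu, lo m' w, ⟨?_, w, hw, rfl⟩, lo_lo h w⟩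
    intro h0; apply hu; rw [← lo_lo h, h0, lo_nil]

theorem hiS_hiS {m m' : ℕ} (h : m ≤ m') (H : Finset W) : hiS m' (hiS m H) = hiS m' H := by
  ext u
  simp only [mem_hiS]
  constructor
  · rintro ⟨hu, v, ⟨_, w, hw, rfl⟩, rfl⟩
    exact ⟨hu, w, hw, (hi_hi h w).symm⟩
  · rintro ⟨hu, w, hw, rfl⟩
    refine ⟨hu, hi m w, ⟨?_, w, hw, rfl⟩, hi_hi h w⟩
    intro h0; apply hu; rw [← hi_hi h, h0, hi_nil]

theorem hiS_loS {m m' : ℕ} (H : Finset W) : hiS m (loS m' H) = loS m' (hiS m H) := by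
  ext u
  simp only [mem_loS, mem_hiS]
  constructor
  · rintro ⟨hu, v, ⟨_, w, hw, rfl⟩, rfl⟩
    refine ⟨hu, hi m w, ⟨?_, w, hw, rfl⟩, (hi_lo w).symm⟩
    intro h0; apply hu; rw [hi_lo, h0, lo_nil]
  · rintro ⟨hu, v, ⟨_, w, hw, rfl⟩, rfl⟩
    refine ⟨hu, lo m' w, ⟨?_, w, hw, rfl⟩, hi_lo w⟩
    intro h0; apply hu; rw [← hi_lo, h0, hi_nil]

theorem Sp.assoc1 {m m' : ℕ} (h : m ≤ m') {H : Finset W} (h1 : Sp m (loS m' H)) (h2 : Sp m' H) :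
    Sp m H ∧ Sp m' (hiS m H) := by
  have key : ∀ w ∈ H, lo m' w ≠ [] → lo m' w ∈ loS m' H := fun w hw hn => mem_loS.2 ⟨hn, w, hw, rfl⟩
  have ehi : ∀ w ∈ H, hi m w = hi m (lo m' w) ++ hi m' w := by
    intro w hw
    conv_lhs => rw [← h2.app w hw, hi_append, hi_hi' h]
  have linj : ∀ w ∈ H, ∀ v ∈ H, lo m w = lo m v → lo m w ≠ [] → w = v := by
    intro w hw v hv he hn
    have h3 : lo m' w ≠ [] := by intro h0; apply hn; rw [← lo_lo h, h0, lo_nil]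
    have h4 : lo m' v ≠ [] := by intro h0; apply hn; rw [he, ← lo_lo h, h0, lo_nil]
    refine h2.linj w hw v hv (h1.linj _ (key w hw h3) _ (key v hv h4) ?_ ?_) h3
    · rw [lo_lo h, lo_lo h, he]
    · rw [lo_lo h]; exact hn
  have mid : ∀ w ∈ H, ∀ v ∈ H, hi m (lo m' w) = hi m (lo m' v) → hi m (lo m' w) ≠ [] → w = v := by
    intro w hw v hv he hn
    have h3 : lo m' w ≠ [] := by intro h0; apply hn; rw [h0, hi_nil]
    have h4 : lo m' v ≠ [] := by intro h0; apply hn; rw [he, h0, hi_nil]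
    exact h2.linj w hw v hv (h1.hinj _ (key w hw h3) _ (key v hv h4) he hn) h3
  refine ⟨⟨h2.nil, ?_, linj, ?_⟩, ⟨by simp [hiS], ?_, ?_, ?_⟩⟩
  · intro w hw
    rw [ehi w hw, ← List.append_assoc, ← lo_lo h]
    by_cases h0 : lo m' w = []
    · have := h2.app w hw
      rw [h0] at this ⊢
      simpa [lo_nil, hi_nil] using this
    · rw [h1.app _ (key w hw h0), h2.app w hw]
  · intro w hw v hv he hn
    by_cases h0 : hi m' w = []
    · have e1 : hi m' w = hi m' v := by rw [← hi_hi h, he, hi_hi h]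
      apply mid w hw v hv
      · rw [hi_lo, he, hi_lo]
      · intro h5; apply hn; rw [ehi w hw, h5, h0]; rfl
    · apply h2.hinj w hw v hv _ h0
      rw [← hi_hi h, he, hi_hi h]
  · intro v hv
    obtain ⟨_, w, hw, rfl⟩ := mem_hiS.1 hv
    rw [hi_hi h, ← hi_lo, ← ehi w hw]
  · intro u hu v hv he hn
    obtain ⟨_, w, hw, rfl⟩ := mem_hiS.1 hu
    obtain ⟨_, w', hw', rfl⟩ := mem_hiS.1 hv
    rw [← hi_lo] at hn
    rw [← hi_lo, ← hi_lo] at he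
    rw [mid w hw w' hw' he hn]
  · intro u hu v hv he hn
    obtain ⟨_, w, hw, rfl⟩ := mem_hiS.1 hu
    obtain ⟨_, w', hw', rfl⟩ := mem_hiS.1 hv
    rw [hi_hi h] at hn
    rw [hi_hi h, hi_hi h] at he
    rw [h2.hinj w hw w' hw' he hn]

theorem Sp.assoc2 {m m' : ℕ} (h : m ≤ m') {H : Finset W} (h1 : Sp m' (hiS m H)) (h2 : Sp m H) :
    Sp m' H ∧ Sp m (loS m' H) := by
  have key : ∀ w ∈ H, hi m w ≠ [] → hi m w ∈ hiS m H := fun w hw hn => mem_hiS.2 ⟨hn, w, hw, rfl⟩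
  have elo : ∀ w ∈ H, lo m' w = lo m w ++ lo m' (hi m w) := by
    intro w hw
    conv_lhs => rw [← h2.app w hw, lo_append, lo_lo' h]
  have hinj : ∀ w ∈ H, ∀ v ∈ H, hi m' w = hi m' v → hi m' w ≠ [] → w = v := by
    intro w hw v hv he hn
    have h3 : hi m w ≠ [] := by intro h0; apply hn; rw [← hi_hi h, h0, hi_nil]
    have h4 : hi m v ≠ [] := by intro h0; apply hn; rw [he, ← hi_hi h, h0, hi_nil]
    refine h2.hinj w hw v hv (h1.hinj _ (key w hw h3) _ (key v hv h4) ?_ ?_) h3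
    · rw [hi_hi h, hi_hi h, he]
    · rw [hi_hi h]; exact hn
  have mid : ∀ w ∈ H, ∀ v ∈ H, lo m' (hi m w) = lo m' (hi m v) → lo m' (hi m w) ≠ [] → w = v := by
    intro w hw v hv he hn
    have h3 : hi m w ≠ [] := by intro h0; apply hn; rw [h0, lo_nil]
    have h4 : hi m v ≠ [] := by intro h0; apply hn; rw [he, h0, lo_nil]
    exact h2.hinj w hw v hv (h1.linj _ (key w hw h3) _ (key v hv h4) he hn) h3
  refine ⟨⟨h2.nil, ?_, ?_, hinj⟩, ⟨by simp [loS], ?_, ?_, ?_⟩⟩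
  · intro w hw
    rw [elo w hw, List.append_assoc, ← hi_hi h]
    by_cases h0 : hi m w = []
    · have := h2.app w hw
      rw [h0] at this ⊢
      simpa [lo_nil, hi_nil] using this
    · rw [h1.app _ (key w hw h0), h2.app w hw]
  · intro w hw v hv he hn
    by_cases h0 : lo m w = []
    · apply mid w hw v hv
      · rw [← hi_lo, he, hi_lo]
      · intro h5; apply hn; rw [elo w hw, h5, h0]; rfl
    · apply h2.linj w hw v hv _ h0
      rw [← lo_lo h, he, lo_lo h]
  · intro v hv
    obtain ⟨_, w, hw, rfl⟩ := mem_loS.1 hv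
    rw [lo_lo h, hi_lo, ← elo w hw]
  · intro u hu v hv he hn
    obtain ⟨_, w, hw, rfl⟩ := mem_loS.1 hu
    obtain ⟨_, w', hw', rfl⟩ := mem_loS.1 hv
    rw [lo_lo h] at hn
    rw [lo_lo h, lo_lo h] at he
    rw [h2.linj w hw w' hw' he hn]
  · intro u hu v hv he hn
    obtain ⟨_, w, hw, rfl⟩ := mem_loS.1 hu
    obtain ⟨_, w', hw', rfl⟩ := mem_loS.1 hv
    rw [hi_lo] at hn
    rw [hi_lo, hi_lo] at he
    rw [mid w hw w' hw' he hn]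

/-! matchings -/

/-- matchings between X and Y -/
noncomputable def Rm (X Y : Finset W) : Finset (Finset (W × W)) :=
  (X ×ˢ Y).powerset.filter (fun Θ => ∀ p ∈ Θ, ∀ q ∈ Θ, (p.1 = q.1 ∨ p.2 = q.2) → p = q)

/-- all results of gluing -/
noncomputable def Prd (X Y : Finset W) : Finset (Finset W) := (Rm X Y).image (glueSet X Y)

/-- X is below level m -/
def Low (m : ℕ) (X : Finset W) : Prop := ∀ u ∈ X, u ≠ [] ∧ ∀ x ∈ u, x ≤ m
/-- Y is above level m -/
def High (m : ℕ) (Y : Finset W) : Prop := ∀ u ∈ Y, u ≠ [] ∧ ∀ x ∈ u, m < x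

theorem mem_glueSet {X Y : Finset W} {Θ : Finset (W × W)} {w : W} :
    w ∈ glueSet X Y Θ ↔ (∃ p ∈ Θ, p.1 ++ p.2 = w) ∨ (w ∈ X ∧ ∀ p ∈ Θ, p.1 ≠ w) ∨
      (w ∈ Y ∧ ∀ p ∈ Θ, p.2 ≠ w) := by
  simp only [glueSet, Finset.mem_union, Finset.mem_image, Finset.mem_filter, or_assoc]

theorem mem_Rm {X Y : Finset W} {Θ : Finset (W × W)} : Θ ∈ Rm X Y ↔
    (∀ p ∈ Θ, p.1 ∈ X ∧ p.2 ∈ Y) ∧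
      ∀ p ∈ Θ, ∀ q ∈ Θ, (p.1 = q.1 ∨ p.2 = q.2) → p = q := by
  simp only [Rm, Finset.mem_filter, Finset.mem_powerset]
  apply and_congr _ Iff.rfl
  constructor
  · intro h p hp; exact Finset.mem_product.1 (h hp)
  · intro h p hp; exact Finset.mem_product.2 (h p hp)

/-- every element of a glued set has its low and high part -/
theorem glue_cases {m : ℕ} {X Y : Finset W} (hX : Low m X) (hY : High m Y)
    {Θ : Finset (W × W)} (hΘ : Θ ∈ Rm X Y) {w : W} (hw : w ∈ glueSet X Y Θ) :
    (lo m w ++ hi m w = w) ∧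
    ((lo m w, hi m w) ∈ Θ ∧ lo m w ∈ X ∧ hi m w ∈ Y ∨
     lo m w = w ∧ hi m w = [] ∧ w ∈ X ∧ (∀ p ∈ Θ, p.1 ≠ lo m w) ∨
     lo m w = [] ∧ hi m w = w ∧ w ∈ Y ∧ (∀ p ∈ Θ, p.2 ≠ hi m w)) := by
  rw [mem_Rm] at hΘ
  rcases mem_glueSet.1 hw with ⟨p, hp, rfl⟩ | ⟨h1, h2⟩ | ⟨h1, h2⟩
  · obtain ⟨h1, h2⟩ := hΘ.1 p hp
    have a1 := lo_eq_self (hX _ h1).2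
    have a2 := hi_eq_nil (hX _ h1).2
    have b1 := lo_eq_nil (hY _ h2).2
    have b2 := hi_eq_self (hY _ h2).2
    rw [lo_append, hi_append, a1, a2, b1, b2]
    simp [hp, h1, h2]
  · have a1 := lo_eq_self (hX _ h1).2
    have a2 := hi_eq_nil (hX _ h1).2
    rw [a1, a2]; simp only [List.append_nil, true_and]
    right; left; exact ⟨h1, h2⟩
  · have b1 := lo_eq_nil (hY _ h1).2
    have b2 := hi_eq_self (hY _ h1).2
    rw [b1, b2]; simp only [List.nil_append, true_and]
    right; right; exact ⟨h1, h2⟩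

theorem isP_glue {m : ℕ} {X Y : Finset W} (hX : Low m X) (hY : High m Y)
    {Θ : Finset (W × W)} (hΘ : Θ ∈ Rm X Y) : IsP m X Y (glueSet X Y Θ) := by
  have hc := fun {w} hw => glue_cases hX hY hΘ (w := w) hw
  have hΘ' := mem_Rm.1 hΘ
  refine ⟨⟨?_, fun w hw => (hc hw).1, ?_, ?_⟩, ?_, ?_⟩
  · intro h
    rcases (hc h).2 with h | h | h
    · exact (hX _ h.2.1).1 (lo_nil m)
    · exact (hX _ h.2.2.1).1 rfl
    · exact (hY _ h.2.2.1).1 rfl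
  · intro w hw v hv he hn
    rcases (hc hw).2 with h | h | h <;> rcases (hc hv).2 with h' | h' | h'
    · have := hΘ'.2 _ h.1 _ h'.1 (Or.inl he)
      rw [← (hc hw).1, ← (hc hv).1]
      simp only [Prod.mk.injEq] at this
      rw [this.1, this.2]
    · exact absurd he (h'.2.2.2 _ h.1)
    · exact absurd (he.trans h'.1) hn
    · exact absurd he.symm (h.2.2.2 _ h'.1)
    · rw [← h.1, ← h'.1, he]
    · exact absurd (he.trans h'.1) hn
    · exact absurd h.1 hn
    · exact absurd h.1 hn
    · exact absurd h.1 hn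
  · intro w hw v hv he hn
    rcases (hc hw).2 with h | h | h <;> rcases (hc hv).2 with h' | h' | h'
    · have := hΘ'.2 _ h.1 _ h'.1 (Or.inr he)
      rw [← (hc hw).1, ← (hc hv).1]
      simp only [Prod.mk.injEq] at this
      rw [this.1, this.2]
    · exact absurd (he.trans h'.2.1) hn
    · exact absurd he (h'.2.2.2 _ h.1)
    · exact absurd h.2.1 hn
    · exact absurd h.2.1 hn
    · exact absurd h.2.1 hn
    · exact absurd he.symm (h.2.2.2 _ h'.1)
    · exact absurd (he.trans h'.2.1) hn
    · rw [← h.2.1, ← h'.2.1, he]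
  · ext u
    rw [mem_loS]
    constructor
    · rintro ⟨hn, w, hw, rfl⟩
      rcases (hc hw).2 with h | h | h
      · exact h.2.1
      · rw [h.1]; exact h.2.2.1
      · exact absurd h.1 hn
    · intro hu
      refine ⟨(hX u hu).1, ?_⟩
      by_cases hex : ∃ p ∈ Θ, p.1 = u
      · obtain ⟨p, hp, rfl⟩ := hex
        refine ⟨p.1 ++ p.2, mem_glueSet.2 (Or.inl ⟨p, hp, rfl⟩), ?_⟩
        rw [lo_append, lo_eq_self (hX _ hu).2, lo_eq_nil (hY _ (hΘ'.1 p hp).2).2, List.append_nil]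
      · push Not at hex
        exact ⟨u, mem_glueSet.2 (Or.inr (Or.inl ⟨hu, hex⟩)), lo_eq_self (hX _ hu).2⟩
  · ext u
    rw [mem_hiS]
    constructor
    · rintro ⟨hn, w, hw, rfl⟩
      rcases (hc hw).2 with h | h | h
      · exact h.2.2
      · exact absurd h.2.1 hn
      · rw [h.2.1]; exact h.2.2.1
    · intro hu
      refine ⟨(hY u hu).1, ?_⟩
      by_cases hex : ∃ p ∈ Θ, p.2 = u
      · obtain ⟨p, hp, rfl⟩ := hex
        refine ⟨p.1 ++ p.2, mem_glueSet.2 (Or.inl ⟨p, hp, rfl⟩), ?_⟩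
        rw [hi_append, hi_eq_self (hY _ hu).2, hi_eq_nil (hX _ (hΘ'.1 p hp).1).2, List.nil_append]
      · push Not at hex
        exact ⟨u, mem_glueSet.2 (Or.inr (Or.inr ⟨hu, hex⟩)), hi_eq_self (hY _ hu).2⟩

/-- the matching recovered from a glued set -/
noncomputable def th (m : ℕ) (G : Finset W) : Finset (W × W) :=
  (G.filter (fun w => lo m w ≠ [] ∧ hi m w ≠ [])).image (fun w => (lo m w, hi m w))

theorem mem_th {m : ℕ} {G : Finset W} {p : W × W} : p ∈ th m G ↔
    ∃ w ∈ G, lo m w ≠ [] ∧ hi m w ≠ [] ∧ (lo m w, hi m w) = p := by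
  simp only [th, Finset.mem_image, Finset.mem_filter, and_assoc]

theorem th_glue {m : ℕ} {X Y : Finset W} (hX : Low m X) (hY : High m Y)
    {Θ : Finset (W × W)} (hΘ : Θ ∈ Rm X Y) : th m (glueSet X Y Θ) = Θ := by
  have hΘ' := mem_Rm.1 hΘ
  ext p
  rw [mem_th]
  constructor
  · rintro ⟨w, hw, h1, h2, rfl⟩
    rcases (glue_cases hX hY hΘ hw).2 with h | h | h
    · exact h.1
    · exact absurd h.2.1 h2
    · exact absurd h.1 h1
  · intro hp
    obtain ⟨h1, h2⟩ := hΘ'.1 p hp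
    have a1 := lo_eq_self (hX _ h1).2
    have a2 := hi_eq_nil (hX _ h1).2
    have b1 := lo_eq_nil (hY _ h2).2
    have b2 := hi_eq_self (hY _ h2).2
    refine ⟨p.1 ++ p.2, mem_glueSet.2 (Or.inl ⟨p, hp, rfl⟩), ?_⟩
    rw [lo_append, hi_append, a1, a2, b1, b2]
    simp [(hX _ h1).1, (hY _ h2).1]

theorem th_mem {m : ℕ} {X Y G : Finset W} (h : IsP m X Y G) : th m G ∈ Rm X Y := by
  rw [mem_Rm]
  constructor
  · intro p hp
    obtain ⟨w, hw, h1, h2, rfl⟩ := mem_th.1 hp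
    rw [← h.low, ← h.high]
    exact ⟨mem_loS.2 ⟨h1, w, hw, rfl⟩, mem_hiS.2 ⟨h2, w, hw, rfl⟩⟩
  · intro p hp q hq he
    obtain ⟨w, hw, h1, h2, rfl⟩ := mem_th.1 hp
    obtain ⟨v, hv, h3, h4, rfl⟩ := mem_th.1 hq
    rcases he with he | he
    · rw [h.sp.linj w hw v hv he h1]
    · rw [h.sp.hinj w hw v hv he h2]

theorem glue_th {m : ℕ} {X Y G : Finset W} (h : IsP m X Y G) : glueSet X Y (th m G) = G := by
  ext w
  rw [mem_glueSet]
  constructor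
  · rintro (⟨p, hp, rfl⟩ | ⟨h1, h2⟩ | ⟨h1, h2⟩)
    · obtain ⟨w, hw, h1, h2, rfl⟩ := mem_th.1 hp
      simp only
      rw [h.sp.app w hw]; exact hw
    · rw [← h.low, mem_loS] at h1
      obtain ⟨hn, v, hv, rfl⟩ := h1
      have h0 : hi m v = [] := by
        by_contra h0
        exact h2 _ (mem_th.2 ⟨v, hv, hn, h0, rfl⟩) rfl
      have := h.sp.app v hv
      rw [h0, List.append_nil] at this
      rw [this]; exact hv
    · rw [← h.high, mem_hiS] at h1
      obtain ⟨hn, v, hv, rfl⟩ := h1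
      have h0 : lo m v = [] := by
        by_contra h0
        exact h2 _ (mem_th.2 ⟨v, hv, h0, hn, rfl⟩) rfl
      have := h.sp.app v hv
      rw [h0, List.nil_append] at this
      rw [this]; exact hv
  · intro hw
    have happ := h.sp.app w hw
    by_cases h1 : lo m w = []
    · right; right
      rw [h1, List.nil_append] at happ
      have hn : hi m w ≠ [] := by rw [happ]; rintro rfl; exact h.sp.nil hw
      constructor
      · rw [← h.high, mem_hiS]; exact ⟨by rwa [← happ], w, hw, happ⟩
      · intro p hp he
        obtain ⟨v, hv, h3, h4, rfl⟩ := mem_th.1 hp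
        simp only at he
        have := h.sp.hinj v hv w hw (he.trans happ.symm) h4
        rw [this] at h3; exact h3 h1
    · by_cases h2 : hi m w = []
      · right; left
        rw [h2, List.append_nil] at happ
        constructor
        · rw [← h.low, mem_loS]; exact ⟨by rwa [← happ], w, hw, happ⟩
        · intro p hp he
          obtain ⟨v, hv, h3, h4, rfl⟩ := mem_th.1 hp
          simp only at he
          have := h.sp.linj v hv w hw (he.trans happ.symm) h3
          rw [this] at h4; exact h4 h2
      · left
        exact ⟨_, mem_th.2 ⟨w, hw, h1, h2, rfl⟩, happ⟩

theorem mem_Prd {m : ℕ} {X Y : Finset W} (hX : Low m X) (hY : High m Y) {G : Finset W} :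
    G ∈ Prd X Y ↔ IsP m X Y G := by
  rw [Prd, Finset.mem_image]
  constructor
  · rintro ⟨Θ, hΘ, rfl⟩; exact isP_glue hX hY hΘ
  · intro h; exact ⟨th m G, th_mem h, glue_th h⟩

theorem sum_Rm {γ : Type*} [AddCommMonoid γ] {m : ℕ} {X Y : Finset W} (hX : Low m X)
    (hY : High m Y) (φ : Finset W → γ) :
    ∑ Θ ∈ Rm X Y, φ (glueSet X Y Θ) = ∑ G ∈ Prd X Y, φ G := by
  rw [Prd, Finset.sum_image]
  intro Θ hΘ Θ' hΘ' h
  rw [← th_glue hX hY hΘ, ← th_glue hX hY hΘ']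
  rw [h]

theorem IsP.Low {m : ℕ} {X Y G : Finset W} (h : IsP m X Y G) : Low m X := by
  intro u hu
  rw [← h.low, mem_loS] at hu
  obtain ⟨hn, w, _, rfl⟩ := hu
  exact ⟨hn, fun x hx => by simpa using (List.mem_filter.1 hx).2⟩

theorem IsP.High {m : ℕ} {X Y G : Finset W} (h : IsP m X Y G) : High m Y := by
  intro u hu
  rw [← h.high, mem_hiS] at hu
  obtain ⟨hn, w, _, rfl⟩ := hu
  exact ⟨hn, fun x hx => by simpa using (List.mem_filter.1 hx).2⟩


theorem IsP.sum {m : ℕ} {X Y G : Finset W} (h : IsP m X Y G) (φ : W → ℕ) (h0 : φ [] = 0)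
    (ha : ∀ u v, φ (u ++ v) = φ u + φ v) :
    ∑ w ∈ G, φ w = ∑ u ∈ X, φ u + ∑ u ∈ Y, φ u := by
  have h1 : ∑ w ∈ G, φ w = ∑ w ∈ G, φ (lo m w) + ∑ w ∈ G, φ (hi m w) := by
    rw [← Finset.sum_add_distrib]
    apply Finset.sum_congr rfl
    intro w hw
    rw [← ha, h.sp.app w hw]
  have e1 : X = (G.filter (fun w => lo m w ≠ [])).image (lo m) := by
    rw [← h.low]; ext u; rw [mem_loS]; simp only [Finset.mem_image, Finset.mem_filter]
    constructor
    · rintro ⟨hn, w, hw, rfl⟩; exact ⟨w, ⟨hw, hn⟩, rfl⟩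
    · rintro ⟨w, ⟨hw, hn⟩, rfl⟩; exact ⟨hn, w, hw, rfl⟩
  have e2 : Y = (G.filter (fun w => hi m w ≠ [])).image (hi m) := by
    rw [← h.high]; ext u; rw [mem_hiS]; simp only [Finset.mem_image, Finset.mem_filter]
    constructor
    · rintro ⟨hn, w, hw, rfl⟩; exact ⟨w, ⟨hw, hn⟩, rfl⟩
    · rintro ⟨w, ⟨hw, hn⟩, rfl⟩; exact ⟨hn, w, hw, rfl⟩
  rw [h1, e1, e2, Finset.sum_image, Finset.sum_image]
  · congr 1
    · symm
      apply Finset.sum_subset (Finset.filter_subset _ _)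
      intro w hw hn
      simp only [Finset.mem_filter, not_and, not_not] at hn
      rw [hn hw, h0]
    · symm
      apply Finset.sum_subset (Finset.filter_subset _ _)
      intro w hw hn
      simp only [Finset.mem_filter, not_and, not_not] at hn
      rw [hn hw, h0]
  · intro w hw v hv he
    simp only [Finset.coe_filter, Set.mem_ofPred_eq] at hw hv
    exact h.sp.hinj w hw.1 v hv.1 he hw.2
  · intro w hw v hv he
    simp only [Finset.coe_filter, Set.mem_ofPred_eq] at hw hv
    exact h.sp.linj w hw.1 v hv.1 he hw.2

theorem IsP.cntS {m : ℕ} {X Y G : Finset W} (h : IsP m X Y G) :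
    cntS G = fun i => cntS X i + cntS Y i := by
  funext i
  exact h.sum (fun w => cnt w i) rfl (fun u v => by simp [cnt])

theorem IsP.length {m : ℕ} {X Y G : Finset W} (h : IsP m X Y G) :
    ∑ w ∈ G, w.length = ∑ w ∈ X, w.length + ∑ w ∈ Y, w.length :=
  h.sum (fun w => w.length) rfl (fun u v => by simp)

theorem IsP.letters {m : ℕ} {X Y G : Finset W} (h : IsP m X Y G) {w : W} (hw : w ∈ G) {x : ℕ}
    (hx : x ∈ w) : (∃ u ∈ X, x ∈ u) ∨ ∃ u ∈ Y, x ∈ u := by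
  rw [← h.sp.app w hw, List.mem_append] at hx
  rcases hx with hx | hx
  · left; exact ⟨lo m w, by rw [← h.low, mem_loS]; exact ⟨List.ne_nil_of_mem hx, w, hw, rfl⟩, hx⟩
  · right; exact ⟨hi m w, by rw [← h.high, mem_hiS]; exact ⟨List.ne_nil_of_mem hx, w, hw, rfl⟩, hx⟩

theorem IsP.posS {m : ℕ} {X Y G : Finset W} (h : IsP m X Y G) (hX : PosS X) (hY : PosS Y) :
    PosS G := by
  intro w hw x hx
  rcases h.letters hw hx with ⟨u, hu, hx⟩ | ⟨u, hu, hx⟩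
  · exact hX u hu x hx
  · exact hY u hu x hx

theorem hd_append_left {u v : W} (h : u ≠ []) : hd (u ++ v) = hd u := by
  cases u with
  | nil => exact absurd rfl h
  | cons x u => rfl

theorem hd_mem {u : W} (h : u ≠ []) : hd u ∈ u := by
  cases u with
  | nil => exact absurd rfl h
  | cons x u => simp [hd]

theorem IsP.good {m : ℕ} {X Y G : Finset W} (h : IsP m X Y G) (hX : Good X) (hY : Good Y) :
    Good G := by
  have hL := h.Low
  have hH := h.High
  have klo : ∀ w ∈ G, lo m w ≠ [] → lo m w ∈ X ∧ hd w = hd (lo m w) ∧ hd w ≤ m := by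
    intro w hw hn
    have h1 : lo m w ∈ X := by rw [← h.low, mem_loS]; exact ⟨hn, w, hw, rfl⟩
    have h2 : hd w = hd (lo m w) := by
      conv_lhs => rw [← h.sp.app w hw, hd_append_left hn]
    refine ⟨h1, h2, ?_⟩
    rw [h2]; exact (hL _ h1).2 _ (hd_mem hn)
  have khi : ∀ w ∈ G, lo m w = [] → w ∈ Y ∧ hi m w = w ∧ m < hd w := by
    intro w hw hn
    have h2 := h.sp.app w hw
    rw [hn, List.nil_append] at h2
    have hne : w ≠ [] := by rintro rfl; exact h.sp.nil hw
    have h1 : w ∈ Y := by rw [← h.high, mem_hiS]; exact ⟨hne, w, hw, h2⟩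
    exact ⟨h1, h2, (hH _ h1).2 _ (hd_mem hne)⟩
  constructor
  · intro w hw
    by_cases hn : lo m w = []
    · exact hY.1 w (khi w hw hn).1
    · obtain ⟨h1, h2, h3⟩ := klo w hw hn
      refine ⟨by rintro rfl; exact h.sp.nil hw, ?_⟩
      intro x hx
      rw [← h.sp.app w hw, List.mem_append] at hx
      change hd w ≤ x
      rcases hx with hx | hx
      · rw [h2]; exact (hX.1 _ h1).2 x hx
      · have : m < x := by simpa using (List.mem_filter.1 hx).2
        omega
  · intro w hw v hv he
    by_cases hn : lo m w = []
    · by_cases hn' : lo m v = []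
      · exact hY.2 w (khi w hw hn).1 v (khi v hv hn').1 he
      · have := (khi w hw hn).2.2; have := (klo v hv hn').2.2; omega
    · by_cases hn' : lo m v = []
      · have := (khi v hv hn').2.2; have := (klo w hw hn).2.2; omega
      · obtain ⟨h1, h2, h3⟩ := klo w hw hn
        obtain ⟨h1', h2', h3'⟩ := klo v hv hn'
        exact h.sp.linj w hw v hv (hX.2 _ h1 _ h1' (by omega)) hn

/-! associativity -/

theorem sum_assoc {γ : Type*} [AddCommMonoid γ] {m m' : ℕ} (hm : m ≤ m') {X Y Z : Finset W}
    (hX : Low m X) (hY : High m Y) (hY' : Low m' Y) (hZ : High m' Z) (φ : Finset W → γ) :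
    ∑ G ∈ Prd X Y, ∑ H ∈ Prd G Z, φ H = ∑ G ∈ Prd Y Z, ∑ H ∈ Prd X G, φ H := by
  have hX' : Low m' X := fun u hu => ⟨(hX u hu).1, fun x hx => ((hX u hu).2 x hx).trans hm⟩
  have hZ' : High m Z := fun u hu => ⟨(hZ u hu).1, fun x hx => lt_of_le_of_lt hm ((hZ u hu).2 x hx)⟩
  have k1 : ∀ G ∈ Prd X Y, Low m' G := by
    intro G hG w hw
    rw [mem_Prd hX hY] at hG
    refine ⟨by rintro rfl; exact hG.sp.nil hw, fun x hx => ?_⟩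
    rcases hG.letters hw hx with ⟨u, hu, hx⟩ | ⟨u, hu, hx⟩
    · exact (hX' u hu).2 x hx
    · exact (hY' u hu).2 x hx
  have k2 : ∀ G ∈ Prd Y Z, High m G := by
    intro G hG w hw
    rw [mem_Prd hY' hZ] at hG
    refine ⟨by rintro rfl; exact hG.sp.nil hw, fun x hx => ?_⟩
    rcases hG.letters hw hx with ⟨u, hu, hx⟩ | ⟨u, hu, hx⟩
    · exact (hY u hu).2 x hx
    · exact (hZ' u hu).2 x hx
  rw [Finset.sum_sigma', Finset.sum_sigma']
  refine Finset.sum_bij' (fun p _ => (⟨hiS m p.2, p.2⟩ : Σ _ : Finset W, Finset W))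
    (fun p _ => (⟨loS m' p.2, p.2⟩ : Σ _ : Finset W, Finset W)) ?_ ?_ ?_ ?_ ?_
  · rintro ⟨G, H⟩ h
    simp only [Finset.mem_sigma] at h ⊢
    have hG := (mem_Prd hX hY).1 h.1
    have hH := (mem_Prd (k1 G h.1) hZ).1 h.2
    have hs := Sp.assoc1 hm (by rw [hH.low]; exact hG.sp) hH.sp
    have q1 : hiS m H ∈ Prd Y Z := by
      rw [mem_Prd hY' hZ]
      refine ⟨hs.2, ?_, ?_⟩
      · rw [← hiS_loS, hH.low, hG.high]
      · rw [hiS_hiS hm, hH.high]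
    refine ⟨q1, ?_⟩
    rw [mem_Prd hX (k2 _ q1)]
    refine ⟨hs.1, ?_, rfl⟩
    rw [← loS_loS hm, hH.low, hG.low]
  · rintro ⟨G, H⟩ h
    simp only [Finset.mem_sigma] at h ⊢
    have hG := (mem_Prd hY' hZ).1 h.1
    have hH := (mem_Prd hX (k2 G h.1)).1 h.2
    have hs := Sp.assoc2 hm (by rw [hH.high]; exact hG.sp) hH.sp
    have q1 : loS m' H ∈ Prd X Y := by
      rw [mem_Prd hX hY]
      refine ⟨hs.2, ?_, ?_⟩
      · rw [loS_loS hm, hH.low]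
      · rw [hiS_loS, hH.high, hG.low]
    refine ⟨q1, ?_⟩
    rw [mem_Prd (k1 _ q1) hZ]
    refine ⟨hs.1, rfl, ?_⟩
    rw [← hiS_hiS hm, hH.high, hG.high]
  · rintro ⟨G, H⟩ h
    simp only [Finset.mem_sigma] at h
    have hH := (mem_Prd (k1 G h.1) hZ).1 h.2
    simp only [hH.low]
  · rintro ⟨G, H⟩ h
    simp only [Finset.mem_sigma] at h
    have hH := (mem_Prd hX (k2 G h.1)).1 h.2
    simp only [hH.high]
  · intros; rfl

/-! letterwise maps -/

theorem lo_map {m m' : ℕ} {f : ℕ → ℕ} {w : W} (h : ∀ x ∈ w, (f x ≤ m' ↔ x ≤ m)) :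
    lo m' (w.map f) = (lo m w).map f := by
  rw [lo, lo, List.filter_map]
  congr 1
  apply List.filter_congr
  intro x hx; simp [h x hx]

theorem hi_map {m m' : ℕ} {f : ℕ → ℕ} {w : W} (h : ∀ x ∈ w, (f x ≤ m' ↔ x ≤ m)) :
    hi m' (w.map f) = (hi m w).map f := by
  rw [hi, hi, List.filter_map]
  congr 1
  apply List.filter_congr
  intro x hx
  have := h x hx
  simp only [Function.comp, decide_eq_decide]; omega

theorem map_left_inv {f g : ℕ → ℕ} {w : W} (h : ∀ x ∈ w, g (f x) = x) : (w.map f).map g = w := by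
  rw [List.map_map]
  conv_rhs => rw [← List.map_id w]
  apply List.map_congr_left
  intro x hx; exact h x hx

theorem mem_mp {f : ℕ → ℕ} {G : Finset W} {u : W} : u ∈ mp f G ↔ ∃ w ∈ G, w.map f = u := by
  simp [mp]

theorem mp_left_inv {f g : ℕ → ℕ} {G : Finset W} (h : ∀ w ∈ G, ∀ x ∈ w, g (f x) = x) :
    mp g (mp f G) = G := by
  ext u
  rw [mem_mp]
  constructor
  · rintro ⟨w, hw, rfl⟩
    obtain ⟨v, hv, rfl⟩ := mem_mp.1 hw
    rw [map_left_inv (h v hv)]; exact hv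
  · intro hu
    exact ⟨u.map f, mem_mp.2 ⟨u, hu, rfl⟩, map_left_inv (h u hu)⟩

theorem mp_congr {f g : ℕ → ℕ} {G : Finset W} (h : ∀ w ∈ G, ∀ x ∈ w, f x = g x) :
    mp f G = mp g G := by
  apply Finset.image_congr
  intro w hw
  exact List.map_congr_left (h w hw)

theorem mp_mp (f g : ℕ → ℕ) (G : Finset W) : mp g (mp f G) = mp (fun x => g (f x)) G := by
  rw [mp, mp, mp, Finset.image_image]
  apply Finset.image_congr
  intro w _
  simp

theorem IsP.map {m m' : ℕ} {f g : ℕ → ℕ} {X Y G : Finset W} (h : IsP m X Y G)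
    (hg : ∀ w ∈ G, ∀ x ∈ w, g (f x) = x) (hf : ∀ w ∈ G, ∀ x ∈ w, (f x ≤ m' ↔ x ≤ m)) :
    IsP m' (mp f X) (mp f Y) (mp f G) := by
  have hl := fun w hw => lo_map (hf w hw)
  have hh := fun w hw => hi_map (hf w hw)
  have gl : ∀ w ∈ G, ((lo m w).map f).map g = lo m w :=
    fun w hw => map_left_inv fun x hx => hg w hw x (List.mem_filter.1 hx).1
  have gh : ∀ w ∈ G, ((hi m w).map f).map g = hi m w :=
    fun w hw => map_left_inv fun x hx => hg w hw x (List.mem_filter.1 hx).1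
  refine ⟨⟨?_, ?_, ?_, ?_⟩, ?_, ?_⟩
  · intro h0
    obtain ⟨w, hw, he⟩ := mem_mp.1 h0
    rw [List.map_eq_nil_iff] at he
    subst he; exact h.sp.nil hw
  · intro u hu
    obtain ⟨w, hw, rfl⟩ := mem_mp.1 hu
    rw [hl w hw, hh w hw, ← List.map_append, h.sp.app w hw]
  · intro u hu v hv he hn
    obtain ⟨w, hw, rfl⟩ := mem_mp.1 hu
    obtain ⟨w', hw', rfl⟩ := mem_mp.1 hv
    rw [hl w hw, hl w' hw'] at he
    rw [hl w hw] at hn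
    rw [h.sp.linj w hw w' hw' (by rw [← gl w hw, he, gl w' hw']) (by simpa using hn)]
  · intro u hu v hv he hn
    obtain ⟨w, hw, rfl⟩ := mem_mp.1 hu
    obtain ⟨w', hw', rfl⟩ := mem_mp.1 hv
    rw [hh w hw, hh w' hw'] at he
    rw [hh w hw] at hn
    rw [h.sp.hinj w hw w' hw' (by rw [← gh w hw, he, gh w' hw']) (by simpa using hn)]
  · ext u
    rw [mem_loS, mem_mp, ← h.low]
    constructor
    · rintro ⟨hn, v, hv, rfl⟩
      obtain ⟨w, hw, rfl⟩ := mem_mp.1 hv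
      rw [hl w hw] at hn
      exact ⟨lo m w, mem_loS.2 ⟨by simpa using hn, w, hw, rfl⟩, (hl w hw).symm⟩
    · rintro ⟨v, hv, rfl⟩
      obtain ⟨hn, w, hw, rfl⟩ := mem_loS.1 hv
      exact ⟨by simpa using hn, w.map f, mem_mp.2 ⟨w, hw, rfl⟩, hl w hw⟩
  · ext u
    rw [mem_hiS, mem_mp, ← h.high]
    constructor
    · rintro ⟨hn, v, hv, rfl⟩
      obtain ⟨w, hw, rfl⟩ := mem_mp.1 hv
      rw [hh w hw] at hn
      exact ⟨hi m w, mem_hiS.2 ⟨by simpa using hn, w, hw, rfl⟩, (hh w hw).symm⟩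
    · rintro ⟨v, hv, rfl⟩
      obtain ⟨hn, w, hw, rfl⟩ := mem_hiS.1 hv
      exact ⟨by simpa using hn, w.map f, mem_mp.2 ⟨w, hw, rfl⟩, hh w hw⟩

theorem sum_Prd_map {γ : Type*} [AddCommMonoid γ] {m m' : ℕ} {f g : ℕ → ℕ} {X Y : Finset W}
    (hX : Low m X) (hY : High m Y)
    (hg : ∀ w ∈ X ∪ Y, ∀ x ∈ w, g (f x) = x) (hf : ∀ w ∈ X ∪ Y, ∀ x ∈ w, (f x ≤ m' ↔ x ≤ m))
    (φ : Finset W → γ) :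
    ∑ G ∈ Prd (mp f X) (mp f Y), φ G = ∑ G ∈ Prd X Y, φ (mp f G) := by
  have hX' : Low m' (mp f X) := by
    intro u hu
    obtain ⟨w, hw, rfl⟩ := mem_mp.1 hu
    refine ⟨by simpa using (hX w hw).1, fun x hx => ?_⟩
    obtain ⟨y, hy, rfl⟩ := List.mem_map.1 hx
    exact (hf w (Finset.mem_union_left _ hw) y hy).2 ((hX w hw).2 y hy)
  have hY' : High m' (mp f Y) := by
    intro u hu
    obtain ⟨w, hw, rfl⟩ := mem_mp.1 hu
    refine ⟨by simpa using (hY w hw).1, fun x hx => ?_⟩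
    obtain ⟨y, hy, rfl⟩ := List.mem_map.1 hx
    have h1 := hf w (Finset.mem_union_right _ hw) y hy
    have h2 := (hY w hw).2 y hy
    omega
  have kl : ∀ G, IsP m X Y G → ∀ w ∈ G, ∀ x ∈ w, ∃ u ∈ X ∪ Y, x ∈ u := by
    intro G hG w hw x hx
    rcases hG.letters hw hx with ⟨u, hu, hx⟩ | ⟨u, hu, hx⟩
    · exact ⟨u, Finset.mem_union_left _ hu, hx⟩
    · exact ⟨u, Finset.mem_union_right _ hu, hx⟩
  have kl' : ∀ G, IsP m' (mp f X) (mp f Y) G → ∀ w ∈ G, ∀ x ∈ w,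
      ∃ u ∈ X ∪ Y, ∃ y ∈ u, f y = x := by
    intro G hG w hw x hx
    rcases hG.letters hw hx with ⟨u, hu, hx⟩ | ⟨u, hu, hx⟩
    · obtain ⟨v, hv, rfl⟩ := mem_mp.1 hu
      exact ⟨v, Finset.mem_union_left _ hv, List.mem_map.1 hx⟩
    · obtain ⟨v, hv, rfl⟩ := mem_mp.1 hu
      exact ⟨v, Finset.mem_union_right _ hv, List.mem_map.1 hx⟩
  have hgl : ∀ G, IsP m X Y G → ∀ w ∈ G, ∀ x ∈ w, g (f x) = x := by
    intro G hG w hw x hx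
    obtain ⟨u, hu, hx⟩ := kl G hG w hw x hx
    exact hg u hu x hx
  have hfl : ∀ G, IsP m' (mp f X) (mp f Y) G → ∀ w ∈ G, ∀ x ∈ w, f (g x) = x := by
    intro G hG w hw x hx
    obtain ⟨u, hu, y, hy, rfl⟩ := kl' G hG w hw x hx
    rw [hg u hu y hy]
  symm
  apply Finset.sum_bij' (fun G _ => mp f G) (fun G _ => mp g G)
  · intro G hG
    rw [mem_Prd hX hY] at hG
    rw [mem_Prd hX' hY']
    apply hG.map (hgl G hG)
    intro w hw x hx
    obtain ⟨u, hu, hx⟩ := kl G hG w hw x hx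
    exact hf u hu x hx
  · intro G hG
    rw [mem_Prd hX' hY'] at hG
    rw [mem_Prd hX hY]
    have := hG.map (m' := m) (f := g) (g := f) (hfl G hG) (by
      intro w hw x hx
      obtain ⟨u, hu, y, hy, rfl⟩ := kl' G hG w hw x hx
      rw [hg u hu y hy, hf u hu y hy])
    rwa [mp_left_inv fun w hw => hg w (Finset.mem_union_left _ hw),
      mp_left_inv fun w hw => hg w (Finset.mem_union_right _ hw)] at this
  · intro G hG
    rw [mem_Prd hX hY] at hG
    exact mp_left_inv (hgl G hG)
  · intro G hG
    rw [mem_Prd hX' hY'] at hG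
    exact mp_left_inv (hfl G hG)
  · intros; rfl

/-! compatibility with the coproduct -/

theorem Sp.subset {m : ℕ} {G S : Finset W} (h : Sp m G) (hS : S ⊆ G) : Sp m S :=
  ⟨fun h0 => h.nil (hS h0), fun w hw => h.app w (hS hw),
    fun w hw v hv => h.linj w (hS hw) v (hS hv), fun w hw v hv => h.hinj w (hS hw) v (hS hv)⟩

theorem Low.subset {m : ℕ} {G S : Finset W} (h : Low m G) (hS : S ⊆ G) : Low m S :=
  fun u hu => h u (hS hu)
theorem High.subset {m : ℕ} {G S : Finset W} (h : High m G) (hS : S ⊆ G) : High m S :=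
  fun u hu => h u (hS hu)

theorem Sp.loS_sdiff {m : ℕ} {G S : Finset W} (h : Sp m G) (hS : S ⊆ G) :
    loS m (G \ S) = loS m G \ loS m S := by
  ext u
  simp only [mem_loS, Finset.mem_sdiff]
  constructor
  · rintro ⟨hn, w, ⟨hw, hwS⟩, rfl⟩
    refine ⟨⟨hn, w, hw, rfl⟩, ?_⟩
    rintro ⟨_, v, hv, he⟩
    rw [h.linj w hw v (hS hv) he.symm hn] at hwS
    exact hwS hv
  · rintro ⟨⟨hn, w, hw, rfl⟩, h2⟩
    exact ⟨hn, w, ⟨hw, fun hwS => h2 ⟨hn, w, hwS, rfl⟩⟩, rfl⟩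

theorem Sp.hiS_sdiff {m : ℕ} {G S : Finset W} (h : Sp m G) (hS : S ⊆ G) :
    hiS m (G \ S) = hiS m G \ hiS m S := by
  ext u
  simp only [mem_hiS, Finset.mem_sdiff]
  constructor
  · rintro ⟨hn, w, ⟨hw, hwS⟩, rfl⟩
    refine ⟨⟨hn, w, hw, rfl⟩, ?_⟩
    rintro ⟨_, v, hv, he⟩
    rw [h.hinj w hw v (hS hv) he.symm hn] at hwS
    exact hwS hv
  · rintro ⟨⟨hn, w, hw, rfl⟩, h2⟩
    exact ⟨hn, w, ⟨hw, fun hwS => h2 ⟨hn, w, hwS, rfl⟩⟩, rfl⟩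

theorem loS_mono {m : ℕ} {G S : Finset W} (hS : S ⊆ G) : loS m S ⊆ loS m G :=
  Finset.erase_subset_erase _ (Finset.image_subset_image hS)
theorem hiS_mono {m : ℕ} {G S : Finset W} (hS : S ⊆ G) : hiS m S ⊆ hiS m G :=
  Finset.erase_subset_erase _ (Finset.image_subset_image hS)
theorem loS_union {m : ℕ} (G S : Finset W) : loS m (G ∪ S) = loS m G ∪ loS m S := by
  rw [loS, Finset.image_union, Finset.erase_union_distrib]; rfl
theorem hiS_union {m : ℕ} (G S : Finset W) : hiS m (G ∪ S) = hiS m G ∪ hiS m S := by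
  rw [hiS, Finset.image_union, Finset.erase_union_distrib]; rfl

theorem sp_union {m : ℕ} {S T : Finset W} (hS : Sp m S) (hT : Sp m T)
    (h1 : Disjoint (loS m S) (loS m T)) (h2 : Disjoint (hiS m S) (hiS m T)) :
    Sp m (S ∪ T) ∧ Disjoint S T := by
  rw [Finset.disjoint_left] at h1 h2
  have l1 : ∀ w ∈ S, ∀ v ∈ T, lo m w = lo m v → lo m w ≠ [] → False := by
    intro w hw v hv he hn
    exact h1 (mem_loS.2 ⟨hn, w, hw, rfl⟩) (mem_loS.2 ⟨hn, v, hv, he.symm⟩)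
  have l2 : ∀ w ∈ S, ∀ v ∈ T, hi m w = hi m v → hi m w ≠ [] → False := by
    intro w hw v hv he hn
    exact h2 (mem_hiS.2 ⟨hn, w, hw, rfl⟩) (mem_hiS.2 ⟨hn, v, hv, he.symm⟩)
  refine ⟨⟨?_, ?_, ?_, ?_⟩, ?_⟩
  · rw [Finset.mem_union]; rintro (h | h)
    · exact hS.nil h
    · exact hT.nil h
  · intro w hw
    rcases Finset.mem_union.1 hw with h | h
    · exact hS.app w h
    · exact hT.app w h
  · intro w hw v hv he hn
    rcases Finset.mem_union.1 hw with h | h <;> rcases Finset.mem_union.1 hv with h' | h'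
    · exact hS.linj w h v h' he hn
    · exact (l1 w h v h' he hn).elim
    · exact (l1 v h' w h he.symm (he ▸ hn)).elim
    · exact hT.linj w h v h' he hn
  · intro w hw v hv he hn
    rcases Finset.mem_union.1 hw with h | h <;> rcases Finset.mem_union.1 hv with h' | h'
    · exact hS.hinj w h v h' he hn
    · exact (l2 w h v h' he hn).elim
    · exact (l2 v h' w h he.symm (he ▸ hn)).elim
    · exact hT.hinj w h v h' he hn
  · rw [Finset.disjoint_left]
    intro w hw hw'
    by_cases h3 : lo m w = []
    · apply l2 w hw w hw' rfl
      intro h4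
      have := hS.app w hw
      rw [h3, h4] at this
      exact hS.nil (by simpa [← this] using hw)
    · exact l1 w hw w hw' rfl h3

theorem sum_delta {γ : Type*} [AddCommMonoid γ] {m : ℕ} {X Y : Finset W}
    (hX : Low m X) (hY : High m Y) (φ : Finset W → Finset W → γ) :
    ∑ G ∈ Prd X Y, ∑ S ∈ G.powerset, φ S (G \ S) =
    ∑ A ∈ X.powerset, ∑ B ∈ Y.powerset, ∑ S ∈ Prd A B, ∑ T ∈ Prd (X \ A) (Y \ B), φ S T := by
  simp only [Finset.sum_sigma']
  have hA : ∀ {A B S}, A ⊆ X → B ⊆ Y → (S ∈ Prd A B ↔ IsP m A B S) :=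
    fun h1 h2 => mem_Prd (hX.subset h1) (hY.subset h2)
  refine Finset.sum_bij'
    (fun p _ => (⟨loS m p.2, ⟨hiS m p.2, ⟨p.2, p.1 \ p.2⟩⟩⟩ :
      Σ _ : Finset W, Σ _ : Finset W, Σ _ : Finset W, Finset W))
    (fun q _ => (⟨q.2.2.1 ∪ q.2.2.2, q.2.2.1⟩ : Σ _ : Finset W, Finset W)) ?_ ?_ ?_ ?_ ?_
  · rintro ⟨G, S⟩ h
    simp only [Finset.mem_sigma, Finset.mem_powerset] at h ⊢
    obtain ⟨hG, hS⟩ := h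
    rw [mem_Prd hX hY] at hG
    have a1 : loS m S ⊆ X := hG.low ▸ loS_mono hS
    have a2 : hiS m S ⊆ Y := hG.high ▸ hiS_mono hS
    refine ⟨a1, a2, ?_, ?_⟩
    · rw [hA a1 a2]; exact ⟨hG.sp.subset hS, rfl, rfl⟩
    · rw [hA Finset.sdiff_subset Finset.sdiff_subset]
      refine ⟨hG.sp.subset Finset.sdiff_subset, ?_, ?_⟩
      · rw [hG.sp.loS_sdiff hS, hG.low]
      · rw [hG.sp.hiS_sdiff hS, hG.high]
  · rintro ⟨A, B, S, T⟩ h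
    simp only [Finset.mem_sigma, Finset.mem_powerset] at h ⊢
    obtain ⟨h1, h2, h3, h4⟩ := h
    rw [hA h1 h2] at h3
    rw [hA Finset.sdiff_subset Finset.sdiff_subset] at h4
    have hu := sp_union h3.sp h4.sp (by rw [h3.low, h4.low]; exact Finset.disjoint_sdiff)
      (by rw [h3.high, h4.high]; exact Finset.disjoint_sdiff)
    refine ⟨?_, Finset.subset_union_left⟩
    rw [mem_Prd hX hY]
    refine ⟨hu.1, ?_, ?_⟩
    · rw [loS_union, h3.low, h4.low, Finset.union_sdiff_of_subset h1]
    · rw [hiS_union, h3.high, h4.high, Finset.union_sdiff_of_subset h2]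
  · rintro ⟨G, S⟩ h
    simp only [Finset.mem_sigma, Finset.mem_powerset] at h
    simp only [Finset.union_sdiff_of_subset h.2]
  · rintro ⟨A, B, S, T⟩ h
    simp only [Finset.mem_sigma, Finset.mem_powerset] at h
    obtain ⟨h1, h2, h3, h4⟩ := h
    rw [hA h1 h2] at h3
    rw [hA Finset.sdiff_subset Finset.sdiff_subset] at h4
    have hu := sp_union h3.sp h4.sp (by rw [h3.low, h4.low]; exact Finset.disjoint_sdiff)
      (by rw [h3.high, h4.high]; exact Finset.disjoint_sdiff)
    simp only [h3.low, h3.high, Finset.union_sdiff_cancel_left hu.2]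
  · rintro ⟨G, S⟩ h
    rfl


/-! shifted sets and the product on basis elements -/

theorem shiftF_toFinset (m : ℕ) (b : W) : (shiftF m (LR b)).toFinset = mp (· + m) (LS b) := by
  ext u
  rw [mem_mp]
  simp [shiftF, LS, shiftW]

theorem sh_eq (m : ℕ) (b : W) : mp (· + m) (LS b) = LS (b.map (· + m)) := by
  rw [LS_map _ _ (by intros; simpa), mp]

theorem Rset_eq (a b : W) : Rset a b = Rm (LS a) (mp (· + a.length) (LS b)) := by
  rw [← shiftF_toFinset]; rfl

theorem mTheta_eq (a b : W) (Θ) :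
    mTheta a b Θ = wordOfSet (glueSet (LS a) (mp (· + a.length) (LS b)) Θ) := by
  rw [← shiftF_toFinset]; rfl

theorem good_sh {m : ℕ} {S : Finset W} (hS : Good S) : Good (mp (· + m) S) := by
  have := good_LS ((wordOfSet S).map (· + m))
  rwa [← sh_eq, LS_wordOfSet hS] at this

theorem posS_sh {m : ℕ} {S : Finset W} (hS : PosS S) : PosS (mp (· + m) S) := by
  intro u hu x hx
  obtain ⟨w, hw, rfl⟩ := mem_mp.1 hu
  obtain ⟨y, hy, rfl⟩ := List.mem_map.1 hx
  have := hS w hw y hy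
  show 1 ≤ y + m
  omega

theorem high_sh {m : ℕ} {S : Finset W} (hg : Good S) (hS : PosS S) : High m (mp (· + m) S) := by
  intro u hu
  obtain ⟨w, hw, rfl⟩ := mem_mp.1 hu
  refine ⟨by simpa using (hg.1 w hw).1, fun x hx => ?_⟩
  obtain ⟨y, hy, rfl⟩ := List.mem_map.1 hx
  have := hS w hw y hy
  show m < y + m
  omega

theorem mem_LS_letters {a u : W} (hu : u ∈ LS a) {x : ℕ} (hx : x ∈ u) : x ∈ a := by
  rw [← wordOfSet_LS a, mem_wordOfSet]; exact ⟨u, hu, hx⟩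

theorem IsPF.low {a : W} (h : IsPF a) : Low a.length (LS a) := by
  intro u hu
  exact ⟨((good_LS a).1 u hu).1, fun x hx => h.le_length (mem_LS_letters hu hx)⟩

theorem IsPF.high {b : W} (h : IsPF b) (m : ℕ) : High m (mp (· + m) (LS b)) :=
  high_sh (good_LS b) (posS_LS h.pos)

theorem map_add_inj (m : ℕ) : Function.Injective (List.map (· + m)) :=
  List.map_injective_iff.2 (add_left_injective m)

theorem cntS_sh_add (m : ℕ) (S : Finset W) (i : ℕ) : cntS (mp (· + m) S) (m + i) = cntS S i := by
  rw [cntS, mp, Finset.sum_image (fun x _ y _ h => map_add_inj m h), cntS]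
  apply Finset.sum_congr rfl
  intro w _
  rw [cnt, cnt, List.countP_map]
  apply List.countP_congr
  intro x _
  simp only [Function.comp, decide_eq_true_eq]; omega

theorem cntS_sh_le {m : ℕ} {S : Finset W} (hS : PosS S) {i : ℕ} (hi : i ≤ m) :
    cntS (mp (· + m) S) i = 0 := by
  rw [cntS, mp, Finset.sum_image (fun x _ y _ h => map_add_inj m h)]
  apply Finset.sum_eq_zero
  intro w hw
  rw [cnt, List.countP_map, List.countP_eq_zero]
  intro x hx
  have := hS w hw x hx
  simp only [Function.comp, decide_eq_true_eq]; omega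

theorem isPF_prd {a b : W} (ha : IsPF a) (hb : IsPF b) {G : Finset W}
    (hG : IsP a.length (LS a) (mp (· + a.length) (LS b)) G) :
    IsPF (wordOfSet G) ∧ (wordOfSet G).length = a.length + b.length := by
  have hl : (wordOfSet G).length = a.length + b.length := by
    rw [length_wordOfSet, hG.sum _ rfl (by simp), ← length_wordOfSet, wordOfSet_LS,
      ← length_wordOfSet, sh_eq, wordOfSet_LS]
    simp
  refine ⟨?_, hl⟩
  rw [isPF_iff]
  refine ⟨(hG.posS (posS_LS ha.pos) (posS_sh (posS_LS hb.pos))).pos, fun i hi => ?_⟩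
  rw [cntS_eq, hG.cntS]
  rw [hl] at hi
  have ha' := ((isPF_iff a).1 ha).2
  have hb' := ((isPF_iff b).1 hb).2
  have ea : ∀ i, cntS (LS a) i = cnt a i := by intro i; rw [← cntS_eq, wordOfSet_LS]
  have eb : ∀ i, cntS (LS b) i = cnt b i := by intro i; rw [← cntS_eq, wordOfSet_LS]
  rcases le_total i a.length with h | h
  · have := ha' i h
    simp only [ea]; omega
  · obtain ⟨j, rfl⟩ := Nat.exists_eq_add_of_le h
    simp only [cntS_sh_add, ea, eb]
    have h1 := cnt_mono a h
    rw [ha.cnt_length] at h1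
    have h2 := hb' j (by omega)
    omega

/-- product of basis elements, as a sum over sets of words -/
theorem sum_Rset {γ : Type*} [AddCommMonoid γ] {a b : W} (ha : IsPF a) (hb : IsPF b) (φ : W → γ) :
    ∑ Θ ∈ Rset a b, φ (mTheta a b Θ) =
      ∑ G ∈ Prd (LS a) (mp (· + a.length) (LS b)), φ (wordOfSet G) := by
  rw [Rset_eq, ← sum_Rm ha.low (hb.high _)]
  simp only [mTheta_eq]

theorem mTheta_PF {a b : W} (ha : IsPF a) (hb : IsPF b) {Θ} (h : Θ ∈ Rset a b) :
    IsPF (mTheta a b Θ) ∧ (mTheta a b Θ).length = a.length + b.length := by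
  rw [Rset_eq] at h
  rw [mTheta_eq]
  exact isPF_prd ha hb ((mem_Prd ha.low (hb.high _)).1 (Finset.mem_image_of_mem _ h))

/-! linear versions -/

noncomputable def wStar (K : Type) [Field K] : FW K →ₗ[K] FW K →ₗ[K] FW K :=
  Finsupp.linearCombination K fun a => Finsupp.linearCombination K fun b => mulSingle K a b

theorem starF_eq (K : Type) [Field K] (x y : FW K) : starF K x y = wStar K x y := by
  rw [starF, wStar, Finsupp.linearCombination_apply, Finsupp.sum, Finsupp.sum,
    LinearMap.sum_apply]
  apply Finset.sum_congr rfl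
  intro a _
  rw [LinearMap.smul_apply, Finsupp.linearCombination_apply, Finsupp.smul_sum]
  simp only [mul_smul]

theorem wStar_Mb (K : Type) [Field K] (a b : W) :
    wStar K (Mb K a) (Mb K b) = mulSingle K a b := by
  simp [wStar, Mb]

theorem wStar_PF (K : Type) [Field K] {a b : W} (ha : IsPF a) (hb : IsPF b) :
    wStar K (Mb K a) (Mb K b) =
      ∑ G ∈ Prd (LS a) (mp (· + a.length) (LS b)), Mb K (wordOfSet G) := by
  rw [wStar_Mb, mulSingle, sum_Rset ha hb]

theorem assoc_Mb (K : Type) [Field K] {a b c : W} (ha : IsPF a) (hb : IsPF b) (hc : IsPF c) :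
    wStar K (wStar K (Mb K a) (Mb K b)) (Mb K c) =
      wStar K (Mb K a) (wStar K (Mb K b) (Mb K c)) := by
  rw [wStar_PF K ha hb, wStar_PF K hb hc, map_sum, map_sum, LinearMap.sum_apply]
  have hbc : b.length = b.length := rfl
  have l1 : ∀ G ∈ Prd (LS a) (mp (· + a.length) (LS b)),
      wStar K (Mb K (wordOfSet G)) (Mb K c) =
        ∑ H ∈ Prd G (mp (· + (a.length + b.length)) (LS c)), Mb K (wordOfSet H) := by
    intro G hG
    rw [mem_Prd ha.low (hb.high _)] at hG
    have h1 := isPF_prd ha hb hG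
    rw [wStar_PF K h1.1 hc, h1.2, LS_wordOfSet (hG.good (good_LS a) (good_sh (good_LS b)))]
  have l2 : ∀ G ∈ Prd (LS b) (mp (· + b.length) (LS c)),
      wStar K (Mb K a) (Mb K (wordOfSet G)) =
        ∑ H ∈ Prd (LS a) (mp (· + a.length) G), Mb K (wordOfSet H) := by
    intro G hG
    rw [mem_Prd hb.low (hc.high _)] at hG
    have h1 := isPF_prd hb hc hG
    rw [wStar_PF K ha h1.1, LS_wordOfSet (hG.good (good_LS b) (good_sh (good_LS c)))]
  rw [Finset.sum_congr rfl l1, Finset.sum_congr rfl l2]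
  rw [sum_assoc (m := a.length) (m' := a.length + b.length) (by omega) ha.low (hb.high _) _
    (hc.high _)]
  · have e : mp (· + (a.length + b.length)) (LS c) =
        mp (· + a.length) (mp (· + b.length) (LS c)) := by
      rw [mp_mp]; congr 1; funext x; omega
    rw [e, sum_Prd_map (m := b.length) (m' := a.length + b.length) (g := (· - a.length)) hb.low
      (hc.high _)
      (by intro w _ x _; simp) (by intro w _ x _; omega)
      (fun G => ∑ H ∈ Prd (LS a) G, Mb K (wordOfSet H))]
  · intro u hu
    obtain ⟨w, hw, rfl⟩ := mem_mp.1 hu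
    refine ⟨by simpa using ((good_LS b).1 w hw).1, fun x hx => ?_⟩
    obtain ⟨y, hy, rfl⟩ := List.mem_map.1 hx
    have := (hb.low w hw).2 y hy
    show y + a.length ≤ _
    omega

theorem isPF_nil : IsPF [] := by
  rw [isPF_iff]; refine ⟨by intro x hx; simp at hx, by intro i hi; simp at hi; omega⟩

theorem LS_nil : LS [] = ∅ := by simp [LS, LR, segs_nil]

theorem unit_left (K : Type) [Field K] (a : W) :
    wStar K (Mb K []) (Mb K a) = Mb K a := by
  rw [wStar_Mb, mulSingle, Rset_eq]
  have : Rm (LS []) (mp (· + ([] : W).length) (LS a)) = {∅} := by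
    rw [LS_nil, Rm]; ext Θ; simp
    rintro rfl; simp
  rw [this, Finset.sum_singleton, mTheta_eq, LS_nil]
  congr 1
  have : glueSet ∅ (mp (· + ([] : W).length) (LS a)) ∅ = LS a := by
    rw [mp, glueSet]; simp
  rw [this, wordOfSet_LS]

theorem unit_right (K : Type) [Field K] (a : W) :
    wStar K (Mb K a) (Mb K []) = Mb K a := by
  rw [wStar_Mb, mulSingle, Rset_eq]
  have : Rm (LS a) (mp (· + a.length) (LS [])) = {∅} := by
    rw [LS_nil, Rm]; ext Θ; simp [mp]
    rintro rfl; simp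
  rw [this, Finset.sum_singleton, mTheta_eq, LS_nil]
  congr 1
  have : glueSet (LS a) (mp (· + a.length) ∅) ∅ = LS a := by
    rw [mp, glueSet]; simp
  rw [this, wordOfSet_LS]

theorem wStar_mem (K : Type) [Field K] {x y : FW K} (hx : x ∈ KPspan K) (hy : y ∈ KPspan K) :
    wStar K x y ∈ KPspan K := by
  induction hx using Submodule.span_induction with
  | zero => simp
  | add x x' _ _ h h' => rw [map_add]; exact Submodule.add_mem _ h h'
  | smul c x _ h => rw [map_smul]; exact Submodule.smul_mem _ c h
  | mem x hx =>
    obtain ⟨a, ha, rfl⟩ := hx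
    induction hy using Submodule.span_induction with
    | zero => simp
    | add x x' _ _ h h' => rw [map_add]; exact Submodule.add_mem _ h h'
    | smul c x _ h => rw [map_smul]; exact Submodule.smul_mem _ c h
    | mem y hy =>
      obtain ⟨b, hb, rfl⟩ := hy
      rw [wStar_Mb]
      apply Submodule.sum_mem
      intro Θ hΘ
      exact Submodule.subset_span ⟨_, (mTheta_PF ha hb hΘ).1, rfl⟩

theorem wStar_assoc (K : Type) [Field K] {x y z : FW K} (hx : x ∈ KPspan K) (hy : y ∈ KPspan K)
    (hz : z ∈ KPspan K) : wStar K (wStar K x y) z = wStar K x (wStar K y z) := by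
  induction hx using Submodule.span_induction with
  | zero => simp
  | add x x' _ _ h h' => simp only [map_add, LinearMap.add_apply, h, h']
  | smul c x _ h => simp only [map_smul, LinearMap.smul_apply, h]
  | mem x hx =>
    obtain ⟨a, ha, rfl⟩ := hx
    induction hy using Submodule.span_induction with
    | zero => simp
    | add x x' _ _ h h' => simp only [map_add, LinearMap.add_apply, h, h']
    | smul c x _ h => simp only [map_smul, LinearMap.smul_apply, h]
    | mem y hy =>
      obtain ⟨b, hb, rfl⟩ := hy
      induction hz using Submodule.span_induction with
      | zero => simp
      | add x x' _ _ h h' => simp only [map_add, h, h']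
      | smul c x _ h => simp only [map_smul, h]
      | mem y hy =>
        obtain ⟨c, hc, rfl⟩ := hy
        exact assoc_Mb K ha hb hc

theorem unit_left' (K : Type) [Field K] (x : FW K) : wStar K (Mb K []) x = x := by
  induction x using Finsupp.induction_linear with
  | zero => simp
  | add x y h h' => rw [map_add, h, h']
  | single a c =>
    have : Finsupp.single a c = c • Mb K a := by simp [Mb]
    rw [this, map_smul, unit_left]

theorem unit_right' (K : Type) [Field K] (x : FW K) : wStar K x (Mb K []) = x := by
  induction x using Finsupp.induction_linear with
  | zero => simp
  | add x y h h' => rw [map_add, LinearMap.add_apply, h, h']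
  | single a c =>
    have : Finsupp.single a c = c • Mb K a := by simp [Mb]
    rw [this, map_smul, LinearMap.smul_apply, unit_right]

/-! coproduct -/

theorem delta_sum (K : Type) [Field K] {V : Type*} [AddCommMonoid V] [Module K V] {S : Finset W}
    (hg : Good S) (hp : PosS S) (F : W × W → V) :
    (deltaSingle K (PkW S)).sum (fun p c => c • F p) =
      ∑ T ∈ S.powerset, F (PkW T, PkW (S \ T)) := by
  rw [← Finsupp.linearCombination_apply, deltaSingle_PkW K hg hp, map_sum]
  simp

theorem delta_sum' (K : Type) [Field K] {V : Type*} [AddCommMonoid V] [Module K V] (a : W)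
    (F : W × W → V) :
    (deltaSingle K a).sum (fun p c => c • F p) =
      ∑ T ∈ (LS a).powerset, F (PkW T, PkW (LS a \ T)) := by
  rw [← Finsupp.linearCombination_apply, deltaSingle_eq, map_sum]
  simp

theorem delta_closed (K : Type) [Field K] {a : W} (ha : IsPF a) :
    ∀ p ∈ (deltaSingle K a).support, IsPF p.1 ∧ IsPF p.2 ∧ p.1.length + p.2.length = a.length := by
  intro p hp
  rw [deltaSingle_eq] at hp
  have := Finsupp.support_finsetSum hp
  obtain ⟨S, hS, h⟩ := Finset.mem_biUnion.1 this
  rw [Finset.mem_powerset] at hS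
  have h2 := Finsupp.support_single_subset h
  rw [Finset.mem_singleton] at h2
  subst h2
  have hP := posS_LS ha.pos
  refine ⟨isPF_PkW (hP.subset hS), isPF_PkW (hP.subset Finset.sdiff_subset), ?_⟩
  rw [length_PkW (hP.subset hS), length_PkW (hP.subset Finset.sdiff_subset), add_comm,
    Finset.sum_sdiff hS, ← length_wordOfSet, wordOfSet_LS]

theorem sum_triple {γ : Type*} [AddCommMonoid γ] (X : Finset W)
    (ψ : Finset W → Finset W → Finset W → γ) :
    ∑ S ∈ X.powerset, ∑ T ∈ S.powerset, ψ T (S \ T) (X \ S) =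
    ∑ S ∈ X.powerset, ∑ T ∈ (X \ S).powerset, ψ S T ((X \ S) \ T) := by
  rw [Finset.sum_sigma', Finset.sum_sigma']
  refine Finset.sum_bij' (fun p _ => (⟨p.2, p.1 \ p.2⟩ : Σ _ : Finset W, Finset W))
    (fun p _ => (⟨p.1 ∪ p.2, p.1⟩ : Σ _ : Finset W, Finset W)) ?_ ?_ ?_ ?_ ?_
  · rintro ⟨S, T⟩ h
    simp only [Finset.mem_sigma, Finset.mem_powerset] at h ⊢
    exact ⟨h.2.trans h.1, Finset.sdiff_subset_sdiff h.1 le_rfl⟩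
  · rintro ⟨S, T⟩ h
    simp only [Finset.mem_sigma, Finset.mem_powerset] at h ⊢
    exact ⟨Finset.union_subset h.1 (h.2.trans Finset.sdiff_subset), Finset.subset_union_left⟩
  · rintro ⟨S, T⟩ h
    simp only [Finset.mem_sigma, Finset.mem_powerset] at h
    simp only [Finset.union_sdiff_of_subset h.2]
  · rintro ⟨S, T⟩ h
    simp only [Finset.mem_sigma, Finset.mem_powerset] at h
    have : Disjoint S T := Finset.disjoint_of_subset_right h.2 Finset.disjoint_sdiff
    simp only [Finset.union_sdiff_cancel_left this]
  · rintro ⟨S, T⟩ h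
    simp only [Finset.mem_sigma, Finset.mem_powerset] at h
    have : (X \ T) \ (S \ T) = X \ S := by
      ext u
      have := @h.2 u
      simp only [Finset.mem_sdiff]; tauto
    simp only [this]

theorem coassoc (K : Type) [Field K] {a : W} (ha : IsPF a) :
    (deltaSingle K a).sum (fun p c => c • delta13 K p) =
        (deltaSingle K a).sum (fun p c => c • delta23 K p) := by
  rw [delta_sum', delta_sum']
  have hP := posS_LS ha.pos
  have hG := good_LS a
  have l1 : ∀ S ∈ (LS a).powerset, delta13 K (PkW S, PkW (LS a \ S)) =
      ∑ T ∈ S.powerset, Finsupp.single (PkW T, PkW (S \ T), PkW (LS a \ S)) 1 := by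
    intro S hS
    rw [Finset.mem_powerset] at hS
    rw [delta13, deltaSingle_PkW K (hG.subset hS) (hP.subset hS), Finsupp.mapDomain_finsetSum]
    simp only [Finsupp.mapDomain_single]
  have l2 : ∀ S ∈ (LS a).powerset, delta23 K (PkW S, PkW (LS a \ S)) =
      ∑ T ∈ (LS a \ S).powerset, Finsupp.single (PkW S, PkW T, PkW ((LS a \ S) \ T)) 1 := by
    intro S hS
    rw [delta23, deltaSingle_PkW K (hG.subset Finset.sdiff_subset)
      (hP.subset Finset.sdiff_subset), Finsupp.mapDomain_finsetSum]
    simp only [Finsupp.mapDomain_single]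
  rw [Finset.sum_congr rfl l1, Finset.sum_congr rfl l2]
  exact sum_triple (LS a) (fun A B C => Finsupp.single (PkW A, PkW B, PkW C) 1)

theorem sum_compl {γ : Type*} [AddCommMonoid γ] (X : Finset W) (φ : Finset W → γ) :
    ∑ S ∈ X.powerset, φ (X \ S) = ∑ S ∈ X.powerset, φ S := by
  refine Finset.sum_bij' (fun S _ => X \ S) (fun S _ => X \ S) ?_ ?_ ?_ ?_ ?_
  · intro S _; simp
  · intro S _; simp
  · intro S hS; rw [Finset.mem_powerset] at hS; simp [Finset.inter_eq_right.2 hS]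
  · intro S hS; rw [Finset.mem_powerset] at hS; simp [Finset.inter_eq_right.2 hS]
  · intros; rfl

theorem cocomm (K : Type) [Field K] (a : W) :
    Finsupp.mapDomain Prod.swap (deltaSingle K a) = deltaSingle K a := by
  rw [deltaSingle_eq, Finsupp.mapDomain_finsetSum]
  simp only [Finsupp.mapDomain_single, Prod.swap]
  rw [← sum_compl]
  apply Finset.sum_congr rfl
  intro S hS
  rw [Finset.mem_powerset] at hS
  simp [Finset.inter_eq_right.2 hS]

theorem counit_left (K : Type) [Field K] {a : W} (ha : IsPF a) :
    (deltaSingle K a).sum (fun p c => (c * epsW K p.1) • Mb K p.2) = Mb K a := by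
  simp only [mul_smul]
  rw [delta_sum' K a (fun p => epsW K p.1 • Mb K p.2), Finset.sum_eq_single ∅]
  · simp [PkW_empty, epsW, PkW_LS ha]
  · intro S hS hn
    rw [Finset.mem_powerset] at hS
    simp [epsW, PkW_eq_nil ((good_LS a).subset hS) ((posS_LS ha.pos).subset hS), hn]
  · simp

theorem counit_right (K : Type) [Field K] {a : W} (ha : IsPF a) :
    (deltaSingle K a).sum (fun p c => (c * epsW K p.2) • Mb K p.1) = Mb K a := by
  rw [← counit_left K ha]
  simp only [mul_smul]
  rw [delta_sum' K a (fun p => epsW K p.1 • Mb K p.2),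
    delta_sum' K a (fun p => epsW K p.2 • Mb K p.1), ← sum_compl]
  apply Finset.sum_congr rfl
  intro S hS
  rw [Finset.mem_powerset] at hS
  simp [Finset.inter_eq_right.2 hS]

theorem eps_mul (K : Type) [Field K] {a b : W} (ha : IsPF a) (hb : IsPF b) :
    (wStar K (Mb K a) (Mb K b)).sum (fun c coef => coef * epsW K c) = epsW K a * epsW K b := by
  have e : ∀ x : FW K, x.sum (fun c coef => coef * epsW K c) =
      Finsupp.linearCombination K (epsW K) x := by
    intro x; rw [Finsupp.linearCombination_apply]; rfl
  rw [e]
  by_cases h : a = []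
  · subst h
    rw [unit_left]
    simp [Mb, epsW]
  · rw [wStar_Mb, mulSingle, map_sum, Finset.sum_eq_zero]
    · simp [epsW, h]
    · intro Θ hΘ
      have h1 := (mTheta_PF ha hb hΘ).2
      have h2 : mTheta a b Θ ≠ [] := by
        intro h3
        rw [h3] at h1
        have := List.length_pos_iff.2 h
        simp at h1; omega
      simp [Mb, epsW, h2]


theorem park_prod {γ : Type*} [AddCommMonoid γ] {a : W} (ha : IsPF a) {A B : Finset W}
    (hA : A ⊆ LS a) (hgB : Good B) (hpB : PosS B) (φ : W → γ) :
    ∑ G ∈ Prd (LS (PkW A)) (mp (· + (PkW A).length) (LS (PkW B))), φ (wordOfSet G) =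
      ∑ G ∈ Prd A (mp (· + a.length) B), φ (PkW G) := by
  have hgA : Good A := (good_LS a).subset hA
  have hpA : PosS A := (posS_LS ha.pos).subset hA
  have hLA : Low a.length A := ha.low.subset hA
  set m := a.length with hm
  set m' := (PkW A).length with hm'
  set B' := mp (· + m) B with hB'
  have hgB' : Good B' := good_sh hgB
  have hpB' : PosS B' := posS_sh hpB
  have hHB : High m B' := high_sh hgB hpB
  have cA : ∀ i, m ≤ i → cntS A i = m' := by
    intro i hi
    rw [hm', length_PkW hpA, cntS]
    apply Finset.sum_congr rfl
    intro w hw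
    rw [cnt, List.countP_eq_length]
    intro x hx
    have := (hLA w hw).2 x hx
    simp only [decide_eq_true_eq]; omega
  have mA := cntS_monotone A
  have mB := cntS_monotone B'
  have mN : Monotone (fun i => cntS A i + cntS B' i) := fun i j h => add_le_add (mA h) (mB h)
  obtain ⟨F, hF⟩ : ∃ F, F = pk (fun i => cntS A i + cntS B' i) := ⟨_, rfl⟩
  have c1 : ∀ x, x ≤ m → F x = pk (cntS A) x := by
    intro x hx
    rw [hF]
    apply pk_congr
    intro i hi
    show cntS A i + cntS B' i = _
    rw [cntS_sh_le hpB (by omega), add_zero]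
  have c2 : m' ≤ F m := by
    rw [c1 m le_rfl]
    have h1 := pk_ineq (T := cntS A) (cntS_monotone (LS a \ A)) m
    have h2 := cntS_split hA
    rw [← h2, ← cntS_eq, wordOfSet_LS, ha.pk_length le_rfl] at h1
    have h3 := congrFun h2 m
    rw [← cntS_eq, wordOfSet_LS, ha.cnt_length, cA m le_rfl] at h3
    omega
  have c3 : ∀ y, F (m + y + 1) = pk (cntS B) (y + 1) + m' := by
    intro y
    induction y with
    | zero =>
      rw [add_zero, hF, pk_succ, ← hF, cA m le_rfl, cntS_sh_le hpB le_rfl, pk_succ]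
      simp [pk, c2, add_comm]
    | succ y ih =>
      have : F (m + (y + 1) + 1) =
          min (F (m + y + 1)) (cntS A (m + (y + 1)) + cntS B' (m + (y + 1))) + 1 := by
        rw [hF]; rfl
      rw [this, ih, cA _ (by omega), hB', cntS_sh_add, pk_succ _ (y + 1)]
      omega
  have lA : ∀ w ∈ A, ∀ x ∈ w, F x ≤ m' := by
    intro w hw x hx
    have h1 := hpA w hw x hx
    have h2 := (hLA w hw).2 x hx
    have h3 := cntS_lt_of_mem hpA ⟨w, hw, hx⟩
    have h4 := mA h2
    rw [cA m le_rfl] at h4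
    rw [c1 x h2]
    obtain ⟨z, rfl⟩ : ∃ z, x = z + 1 := ⟨x - 1, by omega⟩
    rw [pk_succ]
    simp at h3
    omega
  have lB : ∀ w ∈ B', ∀ x ∈ w, m' < F x := by
    intro w hw x hx
    have h2 := (hHB w hw).2 x hx
    obtain ⟨z, rfl⟩ : ∃ z, x = m + z + 1 := ⟨x - m - 1, by omega⟩
    rw [c3]
    have := pk_pos (cntS B) (x := z + 1) (by omega)
    omega
  have hstr : ∀ w ∈ A ∪ B', ∀ x ∈ w, ∀ y, x < y → F x < F y := by
    intro w hw x hx y hxy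
    rw [hF]
    rcases Finset.mem_union.1 hw with h | h
    · apply pk_strict mN _ (hpA w h x hx) hxy
      have h1 := cntS_lt_of_mem hpA ⟨w, h, hx⟩
      have h2 := mB (Nat.sub_le x 1)
      omega
    · apply pk_strict mN _ (hpB' w h x hx) hxy
      have h1 := cntS_lt_of_mem hpB' ⟨w, h, hx⟩
      have h2 := mA (Nat.sub_le x 1)
      omega
  have hinj : Set.InjOn F {x | ∃ w ∈ A ∪ B', x ∈ w} := by
    rintro x ⟨w, hw, hx⟩ y ⟨v, hv, hy⟩ h
    rcases lt_trichotomy x y with h1 | h1 | h1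
    · exact absurd h (hstr w hw x hx y h1).ne
    · exact h1
    · exact absurd h.symm (hstr v hv y hy x h1).ne
  have e1 : LS (PkW A) = mp F A := by
    rw [LS_PkW hgA hpA]
    apply mp_congr
    intro w hw x hx
    rw [c1 x ((hLA w hw).2 x hx)]
  have e2 : mp (· + m') (LS (PkW B)) = mp F B' := by
    rw [LS_PkW hgB hpB, hB', mp_mp, mp_mp]
    apply mp_congr
    intro w hw x hx
    have h1 := hpB w hw x hx
    obtain ⟨z, rfl⟩ : ∃ z, x = z + 1 := ⟨x - 1, by omega⟩
    rw [← c3]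
    congr 1
    omega
  rw [e1, e2, sum_Prd_map (m := m) (m' := m') (g := Function.invFunOn F _) hLA hHB
    (fun w hw x hx => hinj.leftInvOn_invFunOn ⟨w, hw, hx⟩)]
  · apply Finset.sum_congr rfl
    intro G hG
    rw [mem_Prd hLA hHB] at hG
    rw [← wordOfSet_mp_pk (hG.good hgA hgB') (hG.posS hpA hpB'), hG.cntS, hF]
  · intro w hw x hx
    rcases Finset.mem_union.1 hw with h | h
    · have := lA w h x hx
      have := (hLA w h).2 x hx
      omega
    · have := lB w h x hx
      have := (hHB w h).2 x hx
      omega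

noncomputable def wStar2 (K : Type) [Field K] : FW2 K →ₗ[K] FW2 K →ₗ[K] FW2 K :=
  Finsupp.linearCombination K fun a => Finsupp.linearCombination K fun b => star2Single K a b

theorem star2F_eq (K : Type) [Field K] (x y : FW2 K) : star2F K x y = wStar2 K x y := by
  rw [star2F, wStar2, Finsupp.linearCombination_apply, Finsupp.sum, Finsupp.sum,
    LinearMap.sum_apply]
  apply Finset.sum_congr rfl
  intro a _
  rw [LinearMap.smul_apply, Finsupp.linearCombination_apply, Finsupp.smul_sum]
  simp only [mul_smul]

theorem deltaF_eq (K : Type) [Field K] (x : FW K) :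
    deltaF K x = Finsupp.linearCombination K (deltaSingle K) x := by
  rw [deltaF, Finsupp.linearCombination_apply]

theorem deltaF_Mb (K : Type) [Field K] (a : W) : deltaF K (Mb K a) = deltaSingle K a := by
  rw [deltaF_eq]; simp [Mb]

theorem delta_mul (K : Type) [Field K] {a b : W} (ha : IsPF a) (hb : IsPF b) :
    deltaF K (starF K (Mb K a) (Mb K b)) =
      star2F K (deltaF K (Mb K a)) (deltaF K (Mb K b)) := by
  have l1 : ∀ G ∈ Prd (LS a) (mp (· + a.length) (LS b)),
      Finsupp.linearCombination K (deltaSingle K) (Mb K (wordOfSet G)) =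
        ∑ S ∈ G.powerset, Finsupp.single (PkW S, PkW (G \ S)) 1 := by
    intro G hG
    rw [mem_Prd ha.low (hb.high _)] at hG
    rw [← deltaF_eq, deltaF_Mb, deltaSingle_eq,
      LS_wordOfSet (hG.good (good_LS a) (good_sh (good_LS b)))]
  rw [starF_eq, wStar_PF K ha hb, star2F_eq, deltaF_Mb, deltaF_Mb, deltaF_eq, map_sum,
    Finset.sum_congr rfl l1,
    sum_delta ha.low (hb.high _) (fun S T => Finsupp.single (PkW S, PkW T) (1 : K)),
    deltaSingle_eq, deltaSingle_eq, map_sum (wStar2 K), LinearMap.sum_apply]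
  apply Finset.sum_congr rfl
  intro A hA
  rw [Finset.mem_powerset] at hA
  rw [map_sum, mp, sum_powerset_image _ _ (fun x _ y _ h => map_add_inj _ h)]
  apply Finset.sum_congr rfl
  intro B hB
  rw [Finset.mem_powerset] at hB
  rw [← Finset.image_sdiff _ _ (map_add_inj _)]
  have hgb := good_LS b
  have hpb := posS_LS hb.pos
  have hpa := posS_LS ha.pos
  have l2 : wStar2 K (Finsupp.single (PkW A, PkW (LS a \ A)) 1)
      (Finsupp.single (PkW B, PkW (LS b \ B)) 1) =
      star2Single K (PkW A, PkW (LS a \ A)) (PkW B, PkW (LS b \ B)) := by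
    simp [wStar2]
  rw [l2, star2Single]
  simp only
  rw [sum_Rset (isPF_PkW (hpa.subset hA)) (isPF_PkW (hpb.subset hB))
    (fun w => ∑ Θ' ∈ Rset (PkW (LS a \ A)) (PkW (LS b \ B)),
      Finsupp.single (w, mTheta (PkW (LS a \ A)) (PkW (LS b \ B)) Θ') (1 : K)),
    park_prod ha hA (hgb.subset hB) (hpb.subset hB)
    (fun w => ∑ Θ' ∈ Rset (PkW (LS a \ A)) (PkW (LS b \ B)),
      Finsupp.single (w, mTheta (PkW (LS a \ A)) (PkW (LS b \ B)) Θ') (1 : K))]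
  apply Finset.sum_congr rfl
  intro G _
  rw [sum_Rset (isPF_PkW (hpa.subset Finset.sdiff_subset))
    (isPF_PkW (hpb.subset Finset.sdiff_subset)) (fun w => Finsupp.single (PkW G, w) (1 : K)),
    park_prod ha Finset.sdiff_subset (hgb.subset Finset.sdiff_subset)
    (hpb.subset Finset.sdiff_subset) (fun w => Finsupp.single (PkW G, w) (1 : K))]
  rfl


/-! antipode -/

noncomputable def antL (K : Type) [Field K] : Finset W → FW K :=
  Finset.strongInduction fun X ih => if X = ∅ then Mb K [] else
    - ∑ S ∈ X.ssubsets.attach, wStar K (ih S.1 (Finset.mem_ssubsets.1 S.2)) (Mb K (PkW (X \ S.1)))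

noncomputable def antR (K : Type) [Field K] : Finset W → FW K :=
  Finset.strongInduction fun X ih => if X = ∅ then Mb K [] else
    - ∑ S ∈ X.ssubsets.attach, wStar K (Mb K (PkW (X \ S.1))) (ih S.1 (Finset.mem_ssubsets.1 S.2))

theorem antL_eq (K : Type) [Field K] (X : Finset W) : antL K X = if X = ∅ then Mb K [] else
    - ∑ S ∈ X.ssubsets, wStar K (antL K S) (Mb K (PkW (X \ S))) := by
  rw [antL, Finset.strongInduction_eq]
  rw [← Finset.sum_attach X.ssubsets]

theorem antR_eq (K : Type) [Field K] (X : Finset W) : antR K X = if X = ∅ then Mb K [] else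
    - ∑ S ∈ X.ssubsets, wStar K (Mb K (PkW (X \ S))) (antR K S) := by
  rw [antR, Finset.strongInduction_eq]
  rw [← Finset.sum_attach X.ssubsets]

theorem sum_ssub {γ : Type*} [AddCommMonoid γ] (X : Finset W) (φ : Finset W → γ) :
    ∑ S ∈ X.powerset, φ S = φ X + ∑ S ∈ X.ssubsets, φ S := by
  rw [Finset.ssubsets, Finset.add_sum_erase _ _ (Finset.mem_powerset_self X)]

theorem antL_sum (K : Type) [Field K] (X : Finset W) :
    ∑ S ∈ X.powerset, wStar K (antL K S) (Mb K (PkW (X \ S))) =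
      if X = ∅ then Mb K [] else 0 := by
  rw [sum_ssub, Finset.sdiff_self, PkW_empty, unit_right']
  conv_lhs => rw [antL_eq]
  split_ifs with h
  · subst h; simp [Finset.ssubsets]
  · simp

theorem antR_sum' (K : Type) [Field K] (X : Finset W) :
    ∑ S ∈ X.powerset, wStar K (Mb K (PkW (X \ S))) (antR K S) =
      if X = ∅ then Mb K [] else 0 := by
  rw [sum_ssub, Finset.sdiff_self, PkW_empty, unit_left']
  conv_lhs => rw [antR_eq]
  split_ifs with h
  · subst h; simp [Finset.ssubsets]
  · simp

theorem antR_sum (K : Type) [Field K] (X : Finset W) :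
    ∑ S ∈ X.powerset, wStar K (Mb K (PkW S)) (antR K (X \ S)) =
      if X = ∅ then Mb K [] else 0 := by
  rw [← antR_sum', ← sum_compl]
  apply Finset.sum_congr rfl
  intro S hS
  rw [Finset.mem_powerset] at hS
  simp [Finset.inter_eq_right.2 hS]

theorem Mb_mem (K : Type) [Field K] {S : Finset W} (h : PosS S) : Mb K (PkW S) ∈ KPspan K :=
  Submodule.subset_span ⟨_, isPF_PkW h, rfl⟩

theorem one_mem (K : Type) [Field K] : Mb K [] ∈ KPspan K :=
  Submodule.subset_span ⟨_, isPF_nil, rfl⟩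

theorem antL_mem (K : Type) [Field K] (X : Finset W) (h : PosS X) : antL K X ∈ KPspan K := by
  induction X using Finset.strongInduction with
  | H X ih =>
    rw [antL_eq]
    split_ifs
    · exact one_mem K
    · apply Submodule.neg_mem
      apply Submodule.sum_mem
      intro S hS
      rw [Finset.mem_ssubsets] at hS
      exact wStar_mem K (ih S hS (h.subset hS.1)) (Mb_mem K (h.subset Finset.sdiff_subset))

theorem antR_mem (K : Type) [Field K] (X : Finset W) (h : PosS X) : antR K X ∈ KPspan K := by
  induction X using Finset.strongInduction with
  | H X ih =>
    rw [antR_eq]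
    split_ifs
    · exact one_mem K
    · apply Submodule.neg_mem
      apply Submodule.sum_mem
      intro S hS
      rw [Finset.mem_ssubsets] at hS
      exact wStar_mem K (Mb_mem K (h.subset Finset.sdiff_subset)) (ih S hS (h.subset hS.1))

theorem antL_mp (K : Type) [Field K] {f : ℕ → ℕ} (X : Finset W)
    (h1 : ∀ T ⊆ X, PkW (mp f T) = PkW T) (h2 : Set.InjOn (List.map f) (X : Set W)) :
    antL K (mp f X) = antL K X := by
  induction X using Finset.strongInduction with
  | H X ih =>
    have e1 := antL_sum K (mp f X)
    have e2 := antL_sum K X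
    have e3 : (if mp f X = ∅ then Mb K [] else 0) = (if X = ∅ then Mb K [] else 0) := by
      simp [mp]
    rw [e3, ← e2, mp, sum_powerset_image _ _ h2, sum_ssub, sum_ssub] at e1
    have e4 : ∀ S ∈ X.ssubsets, wStar K (antL K (S.image (List.map f)))
        (Mb K (PkW (X.image (List.map f) \ S.image (List.map f)))) =
        wStar K (antL K S) (Mb K (PkW (X \ S))) := by
      intro S hS
      rw [Finset.mem_ssubsets] at hS
      have e5 : X.image (List.map f) \ S.image (List.map f) = mp f (X \ S) := by
        rw [mp, Finset.image_sdiff_of_injOn h2 hS.1]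
      rw [e5, h1 _ Finset.sdiff_subset]
      have := ih S hS (fun T hT => h1 T (hT.trans hS.1)) (h2.mono (by exact_mod_cast hS.1))
      rw [mp] at this
      rw [this]
    rw [Finset.sum_congr rfl e4] at e1
    have e6 := add_right_cancel e1
    rw [Finset.sdiff_self, Finset.sdiff_self, PkW_empty, unit_right', unit_right'] at e6
    exact e6

theorem antL_PkW (K : Type) [Field K] {S : Finset W} (hg : Good S) (hp : PosS S) :
    antL K (LS (PkW S)) = antL K S := by
  rw [LS_PkW hg hp]
  exact antL_mp K S (fun T hT => PkW_mp hg hp hT) (map_injOn_pk hp)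

theorem antL_eq_antR (K : Type) [Field K] {X : Finset W} (hp : PosS X) :
    antL K X = antR K X := by
  have h := sum_triple X (fun A B C => wStar K (antL K A) (wStar K (Mb K (PkW B)) (antR K C)))
  have r : ∑ S ∈ X.powerset, ∑ T ∈ (X \ S).powerset,
      wStar K (antL K S) (wStar K (Mb K (PkW T)) (antR K ((X \ S) \ T))) = antL K X := by
    simp only [← map_sum, antR_sum]
    rw [Finset.sum_eq_single X]
    · simp [unit_right']
    · intro S hS hn
      rw [Finset.mem_powerset] at hS
      have : X \ S ≠ ∅ := by
        rw [Ne, Finset.sdiff_eq_empty_iff_subset]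
        intro h; exact hn (Finset.Subset.antisymm hS h)
      simp [this]
    · simp
  have l : ∑ S ∈ X.powerset, ∑ T ∈ S.powerset,
      wStar K (antL K T) (wStar K (Mb K (PkW (S \ T))) (antR K (X \ S))) = antR K X := by
    have : ∀ S ∈ X.powerset, ∑ T ∈ S.powerset,
        wStar K (antL K T) (wStar K (Mb K (PkW (S \ T))) (antR K (X \ S))) =
        wStar K (if S = ∅ then Mb K [] else 0) (antR K (X \ S)) := by
      intro S hS
      rw [Finset.mem_powerset] at hS
      rw [← antL_sum, map_sum, LinearMap.sum_apply]
      apply Finset.sum_congr rfl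
      intro T hT
      rw [Finset.mem_powerset] at hT
      rw [wStar_assoc K (antL_mem K T (hp.subset (hT.trans hS)))
        (Mb_mem K (hp.subset (Finset.sdiff_subset.trans hS)))
        (antR_mem K _ (hp.subset Finset.sdiff_subset))]
    rw [Finset.sum_congr rfl this, Finset.sum_eq_single ∅]
    · simp [unit_left']
    · intro S _ hn; simp [hn]
    · simp
  rw [← r, ← l]
  exact h.symm

theorem LS_eq_empty {a : W} : LS a = ∅ ↔ a = [] := by
  constructor
  · intro h; rw [← wordOfSet_LS a, h, wordOfSet_empty]
  · rintro rfl; exact LS_nil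

theorem antipode_exists (K : Type) [Field K] :
    ∃ S : W → FW K, (∀ a : W, IsPF a → S a ∈ KPspan K) ∧
      ∀ a : W, IsPF a →
        (deltaSingle K a).sum (fun p c => c • starF K (S p.1) (Mb K p.2)) =
          epsW K a • Mb K [] ∧
        (deltaSingle K a).sum (fun p c => c • starF K (Mb K p.1) (S p.2)) =
          epsW K a • Mb K [] := by
  refine ⟨fun a => antL K (LS a), fun a ha => antL_mem K _ (posS_LS ha.pos), fun a ha => ?_⟩
  have hg := good_LS a
  have hp := posS_LS ha.pos
  have e : epsW K a • Mb K [] = if LS a = ∅ then Mb K [] else 0 := by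
    by_cases h : a = []
    · subst h; simp [LS_nil, epsW]
    · rw [if_neg (by rwa [LS_eq_empty]), epsW, if_neg h, zero_smul]
  constructor
  · rw [delta_sum' K a (fun p => starF K (antL K (LS p.1)) (Mb K p.2)), e, ← antL_sum]
    apply Finset.sum_congr rfl
    intro S hS
    rw [Finset.mem_powerset] at hS
    simp only [starF_eq]
    rw [antL_PkW K (hg.subset hS) (hp.subset hS)]
  · rw [delta_sum' K a (fun p => starF K (Mb K p.1) (antL K (LS p.2))), e, ← antR_sum]
    apply Finset.sum_congr rfl
    intro S hS
    simp only [starF_eq]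
    rw [antL_PkW K (hg.subset Finset.sdiff_subset) (hp.subset Finset.sdiff_subset),
      antL_eq_antR K (hp.subset Finset.sdiff_subset)]

/-- `PFSym = (KP, ⋆, Δ)` is a graded (by word length)
cocommutative Hopf algebra with unit `M_ε` and counit `ε`:
the product is closed on `KP`, graded and associative with unit `M_ε`;
the coproduct is closed and graded, coassociative, cocommutative, with counit `ε`;
`Δ` and `ε` are algebra morphisms; and an antipode exists. -/
theorem stmt7 (K : Type) [Field K] [CharZero K] :
    -- the product is closed on KP and graded
    (∀ a b : W, IsPF a → IsPF b → ∀ Θ ∈ Rset a b,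
      IsPF (mTheta a b Θ) ∧ (mTheta a b Θ).length = a.length + b.length) ∧
    -- associativity and unit
    (∀ a b c : W, IsPF a → IsPF b → IsPF c →
      starF K (starF K (Mb K a) (Mb K b)) (Mb K c) =
        starF K (Mb K a) (starF K (Mb K b) (Mb K c))) ∧
    (∀ a : W, IsPF a →
      starF K (Mb K []) (Mb K a) = Mb K a ∧ starF K (Mb K a) (Mb K []) = Mb K a) ∧
    -- the coproduct is closed on KP ⊗ KP and graded
    (∀ a : W, IsPF a → ∀ p ∈ (deltaSingle K a).support,
      IsPF p.1 ∧ IsPF p.2 ∧ p.1.length + p.2.length = a.length) ∧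
    -- coassociativity
    (∀ a : W, IsPF a →
      (deltaSingle K a).sum (fun p c => c • delta13 K p) =
        (deltaSingle K a).sum (fun p c => c • delta23 K p)) ∧
    -- cocommutativity
    (∀ a : W, IsPF a →
      Finsupp.mapDomain Prod.swap (deltaSingle K a) = deltaSingle K a) ∧
    -- counit laws
    (∀ a : W, IsPF a →
      (deltaSingle K a).sum (fun p c => (c * epsW K p.1) • Mb K p.2) = Mb K a ∧
      (deltaSingle K a).sum (fun p c => (c * epsW K p.2) • Mb K p.1) = Mb K a) ∧
    -- Δ is an algebra morphism
    (∀ a b : W, IsPF a → IsPF b →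
      deltaF K (starF K (Mb K a) (Mb K b)) =
        star2F K (deltaF K (Mb K a)) (deltaF K (Mb K b))) ∧
    -- ε is an algebra morphism
    (∀ a b : W, IsPF a → IsPF b →
      (starF K (Mb K a) (Mb K b)).sum (fun c coef => coef * epsW K c) =
        epsW K a * epsW K b) ∧
    -- an antipode exists
    (∃ S : W → FW K, (∀ a : W, IsPF a → S a ∈ KPspan K) ∧
      ∀ a : W, IsPF a →
        (deltaSingle K a).sum (fun p c => c • starF K (S p.1) (Mb K p.2)) =
          epsW K a • Mb K [] ∧
        (deltaSingle K a).sum (fun p c => c • starF K (Mb K p.1) (S p.2)) =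
          epsW K a • Mb K []) := by
  refine ⟨fun a b ha hb Θ hΘ => mTheta_PF ha hb hΘ, fun a b c ha hb hc => ?_, fun a _ => ?_,
    fun a ha => delta_closed K ha, fun a ha => coassoc K ha, fun a _ => cocomm K a,
    fun a ha => ⟨counit_left K ha, counit_right K ha⟩, fun a b ha hb => delta_mul K ha hb,
    fun a b ha hb => ?_, antipode_exists K⟩
  · simp only [starF_eq]
    exact assoc_Mb K ha hb hc
  · simp only [starF_eq]
    exact ⟨unit_left K a, unit_right K a⟩
  · rw [starF_eq]
    exact eps_mul K ha hb
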